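/- Let n ≥ 3, let F be the free group on x_1, …, x_n, let w ∈ F be nontrivial, not primitive and not a proper power, and set G = F/⟨⟨w⟩⟩. Suppose that G is residually finite and that every finite-index subgroup of G is a one-relator group. Suppose further that there is a subgroup K ≤ F of rank 2 with w ∈ K such that, setting P = K/⟨⟨w⟩⟩_K (the quotient of K by the normal closure of w in K), the canonical homomorphism P → G is injective and P is not a free group; identify P with its image in G. Then for every normal subgroup H of G of finite index and every prime p, dim_{F_p} H^2(H ∩ P; F_p) ≤ 1. -/

import Mathlib

/-- A group is a one-relator group if it admits a presentation with finitely many generators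
and a single relator. -/
def IsOneRelatorGroup (G : Type*) [Group G] : Prop :=
  ∃ (m : ℕ) (r : FreeGroup (Fin m)),
    Nonempty (G ≃* PresentedGroup ({r} : Set (FreeGroup (Fin m))))

/-- A group is residually finite if every nontrivial element avoids some finite-index normal
subgroup (equivalently, has nontrivial image in some finite quotient). -/
def ResiduallyFinite (G : Type*) [Group G] : Prop :=
  ∀ g : G, g ≠ 1 → ∃ N : Subgroup G, N.Normal ∧ N.FiniteIndex ∧ g ∉ N

/-- The canonical homomorphism `P = K/⟨⟨w⟩⟩_K → G = F/⟨⟨w⟩⟩` induced by the inclusion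
`K ≤ F`. -/
noncomputable def canonicalMap (n : ℕ) (w : FreeGroup (Fin n))
    (K : Subgroup (FreeGroup (Fin n))) (hwK : w ∈ K) :
    (↥K ⧸ Subgroup.normalClosure {(⟨w, hwK⟩ : K)}) →*
      (FreeGroup (Fin n) ⧸ Subgroup.normalClosure {w}) :=
  QuotientGroup.lift _
    ((QuotientGroup.mk' (Subgroup.normalClosure {w})).comp K.subtype)
    (by
      apply Subgroup.normalClosure_le_normal
      intro x hx
      simp only [Set.mem_singleton_iff] at hx
      subst hx
      simp only [SetLike.mem_coe, MonoidHom.mem_ker, MonoidHom.comp_apply,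
        Subgroup.coe_subtype, QuotientGroup.mk'_apply]
      rw [QuotientGroup.eq_one_iff]
      exact Subgroup.subset_normalClosure rfl)

namespace FreeGroup

section Order

variable {α : Type*} [DecidableEq α]

/-- Left multiplication by the generator `x` on noncommutative integral power series in which
squares of generators vanish. -/
def magnusLeft (x : α) : (List α → ℤ) →ₗ[ℤ] (List α → ℤ) where
  toFun f l := match l with
    | [] => 0
    | y :: t => if y = x ∧ t.head? ≠ some x then f t else 0
  map_add' f g := by
    funext l
    cases l with
    | nil => simp
    | cons y t => by_cases h : y = x ∧ t.head? ≠ some x <;> simp [h]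
  map_smul' c f := by
    funext l
    cases l with
    | nil => simp
    | cons y t => by_cases h : y = x ∧ t.head? ≠ some x <;> simp [h]

/-- Right multiplication by the generator `x`, in the same ring as `magnusLeft`. -/
def magnusRight (x : α) : (List α → ℤ) →ₗ[ℤ] (List α → ℤ) where
  toFun f l :=
    if l.getLast? = some x ∧ l.dropLast.getLast? ≠ some x then f l.dropLast else 0
  map_add' f g := by
    funext l
    by_cases h : l.getLast? = some x ∧ l.dropLast.getLast? ≠ some x <;> simp [h]
  map_smul' c f := by
    funext l
    by_cases h : l.getLast? = some x ∧ l.dropLast.getLast? ≠ some x <;> simp [h]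

@[simp] lemma magnusLeft_nil (x : α) (f : List α → ℤ) : magnusLeft x f [] = 0 := rfl

@[simp] lemma magnusLeft_cons (x : α) (f : List α → ℤ) (y : α) (t : List α) :
    magnusLeft x f (y :: t) = if y = x ∧ t.head? ≠ some x then f t else 0 := rfl

lemma magnusRight_apply (x : α) (f : List α → ℤ) (l : List α) :
    magnusRight x f l =
      if l.getLast? = some x ∧ l.dropLast.getLast? ≠ some x then f l.dropLast else 0 := rfl

lemma magnusLeft_sq (x : α) (f : List α → ℤ) : magnusLeft x (magnusLeft x f) = 0 := by
  funext l
  match l with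
  | [] => rfl
  | [y] => simp
  | y :: z :: t => simp; grind

lemma magnusLeft_magnusRight (x y : α) (f : List α → ℤ) :
    magnusLeft x (magnusRight y f) = magnusRight y (magnusLeft x f) := by
  funext l
  match l with
  | [] => simp [magnusRight_apply]
  | [z] => simp [magnusRight_apply]
  | [z, z'] => simp [magnusRight_apply]; grind
  | z :: z' :: z'' :: t => simp [magnusRight_apply]; grind

/-- Multiplication by `1 + x` on power series. -/
def magnusGen (x : α) : (List α → ℤ) ≃ₗ[ℤ] (List α → ℤ) where
  toLinearMap := LinearMap.id + magnusLeft x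
  invFun f := f - magnusLeft x f
  left_inv f := by simp [magnusLeft_sq]
  right_inv f := by simp [magnusLeft_sq]

@[simp] lemma magnusGen_apply (x : α) (f : List α → ℤ) :
    magnusGen x f = f + magnusLeft x f := rfl

@[simp] lemma magnusGen_inv_apply (x : α) (f : List α → ℤ) :
    (magnusGen x)⁻¹ f = f - magnusLeft x f := rfl

/-- The Magnus representation of a free group, modulo squares of generators. -/
def magnus : FreeGroup α →* ((List α → ℤ) ≃ₗ[ℤ] (List α → ℤ)) := lift magnusGen

@[simp] lemma magnus_of (x : α) : magnus (of x) = magnusGen x := lift_apply_of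

lemma magnus_magnusRight (g : FreeGroup α) (x : α) (f : List α → ℤ) :
    magnus g (magnusRight x f) = magnusRight x (magnus g f) := by
  induction g using FreeGroup.induction_on generalizing f with
  | C1 => simp
  | of a => simp [magnusLeft_magnusRight]
  | inv_of a _ => simp [magnusLeft_magnusRight]
  | mul a b ha hb => simp [ha, hb]

/-- The Magnus expansion of an element of a free group. -/
def magnusSeries (g : FreeGroup α) : List α → ℤ := magnus g (Pi.single [] 1)

lemma magnusLeft_single_nil (x : α) :
    magnusLeft x (Pi.single [] 1) = magnusRight x (Pi.single [] 1) := by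
  funext l
  match l with
  | [] => simp [magnusRight_apply]
  | [z] => simp [magnusRight_apply]
  | z :: z' :: t => simp [magnusRight_apply]

lemma magnusSeries_conj (x : α) (g : FreeGroup α) :
    magnusSeries (of x * g * (of x)⁻¹) = magnusSeries g - magnusRight x (magnusSeries g) +
      magnusLeft x (magnusSeries g - magnusRight x (magnusSeries g)) := by
  simp [magnusSeries, magnusLeft_single_nil, magnus_magnusRight]

lemma magnusSeries_conj_inv (x : α) (g : FreeGroup α) :
    magnusSeries ((of x)⁻¹ * g * of x) = magnusSeries g + magnusRight x (magnusSeries g) -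
      magnusLeft x (magnusSeries g + magnusRight x (magnusSeries g)) := by
  simp [magnusSeries, magnusLeft_single_nil, magnus_magnusRight]

lemma magnusLeft_congr (x : α) {f g : List α → ℤ} {l : List α}
    (h : ∀ t : List α, t.length < l.length → f t = g t) :
    magnusLeft x f l = magnusLeft x g l := by
  cases l with
  | nil => rfl
  | cons y t => simp [h t (by simp)]

lemma magnusRight_congr (x : α) {f g : List α → ℤ} {l : List α}
    (h : ∀ t : List α, t.length < l.length → f t = g t) :
    magnusRight x f l = magnusRight x g l := by
  rcases eq_or_ne l [] with rfl | hl
  · simp [magnusRight_apply]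
  · have := List.length_pos_iff.2 hl
    simp [magnusRight_apply, h l.dropLast (by simp; omega)]

/-- The functions supported in degree `k` whose support is led by the letter `x`. -/
def leadingAt (x : α) : Set (List α → ℤ) :=
  {f | ∃ k, (∀ l : List α, k < l.length → f l = 0) ∧
    (∀ l : List α, l.length = k → f l ≠ 0 → l.head? = some x) ∧ ∃ l, l.length = k ∧ f l ≠ 0}

lemma add_smul_magnusLeft_mem_leadingAt {x : α} {e : ℤ} (he : e ≠ 0) {f : List α → ℤ}
    (hf : f = Pi.single [] 1 ∨ ∃ y ≠ x, f ∈ leadingAt y) :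
    f + e • magnusLeft x f ∈ leadingAt x := by
  obtain ⟨k, hk, hx, l, hl, hfl⟩ : ∃ k, (∀ l : List α, k < l.length → f l = 0) ∧
      (∀ l : List α, l.length = k → f l ≠ 0 → l.head? ≠ some x) ∧
      ∃ l, l.length = k ∧ f l ≠ 0 := by
    rcases hf with rfl | ⟨y, hy, k, hk, hx, h⟩
    · refine ⟨0, fun l hl ↦ ?_, fun l hl ↦ ?_, [], rfl, by simp⟩
      · rw [Pi.single_eq_of_ne]
        rintro rfl
        simp at hl
      · simp [List.length_eq_zero_iff.1 hl]
    · exact ⟨k, hk, fun l hl hfl ↦ by rw [hx l hl hfl]; simpa using hy, h⟩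
  refine ⟨k + 1, fun t ht ↦ ?_, fun t ht htf ↦ ?_, x :: l, by simp [hl], ?_⟩
  · cases t with
    | nil => simp at ht
    | cons y t =>
      have h1 : k < t.length := by simpa using ht
      simp [hk t h1, hk (y :: t) (by simp; omega)]
  · cases t with
    | nil => simp at ht
    | cons y t =>
      have h1 : k < (y :: t).length := by omega
      simp [hk _ h1] at htf
      simp [htf.1]
  · have h1 : k < (x :: l).length := by simp [hl]
    simp [hk _ h1, he, hfl, hx l hl hfl]

lemma magnusSeries_mk_cons {L : List (α × Bool)} {x : α} {b : Bool}
    (hL : IsReduced ((x, b) :: L)) : ∃ (e : ℤ) (f : List α → ℤ),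
      (bif b then 0 < e else e < 0) ∧ (f = Pi.single [] 1 ∨ ∃ y ≠ x, f ∈ leadingAt y) ∧
      magnusSeries (mk ((x, b) :: L)) = f + e • magnusLeft x f := by
  have key (L : List (α × Bool)) (x : α) (b : Bool) : magnusSeries (mk ((x, b) :: L)) =
      magnusSeries (mk L) + (bif b then 1 else -1 : ℤ) • magnusLeft x (magnusSeries (mk L)) := by
    have : mk ((x, b) :: L) = (bif b then of x else (of x)⁻¹) * mk L := by
      cases b <;> simp [of, invRev]
    rw [this]
    cases b <;> simp [magnusSeries, sub_eq_add_neg]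
  induction L generalizing x b with
  | nil =>
    refine ⟨bif b then 1 else -1, Pi.single [] 1, by cases b <;> simp, .inl rfl, ?_⟩
    rw [key]
    have : magnusSeries (mk ([] : List (α × Bool))) = Pi.single [] 1 := by
      rw [← one_eq_mk]; simp [magnusSeries]
    rw [this]
  | cons p L ih =>
    obtain ⟨x', b'⟩ := p
    rw [isReduced_cons_cons] at hL
    obtain ⟨e, f, he, hf, h⟩ := ih hL.2
    rw [key]
    by_cases hx : x = x'
    · obtain rfl := hx
      obtain rfl := hL.1 rfl
      refine ⟨e + bif b then 1 else -1, f, ?_, hf, ?_⟩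
      · cases b <;> simp at he ⊢ <;> omega
      · rw [h]
        simp only [map_add, map_smul, magnusLeft_sq, smul_zero, add_zero, add_smul, add_assoc]
    · refine ⟨bif b then 1 else -1, _, by cases b <;> simp, .inr ⟨x', Ne.symm hx, ?_⟩, rfl⟩
      rw [h]
      exact add_smul_magnusLeft_mem_leadingAt (by cases b' <;> simp at he <;> omega) hf

lemma eq_one_of_magnusSeries_eq {g : FreeGroup α} (h : magnusSeries g = Pi.single [] 1) :
    g = 1 := by
  by_contra hg
  have hr : IsReduced g.toWord := isReduced_toWord
  obtain ⟨p, L, hp⟩ := List.exists_cons_of_ne_nil (mt toWord_eq_nil_iff.1 hg)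
  rw [hp] at hr
  obtain ⟨e, f, he, hf, h'⟩ := magnusSeries_mk_cons hr
  have hm := add_smul_magnusLeft_mem_leadingAt
    (x := p.1) (e := e) (by cases hb : p.2 <;> simp [hb] at he <;> omega) hf
  rw [← h', Prod.mk.eta, ← hp, mk_toWord, h] at hm
  obtain ⟨k, hk, hx, l, hl, hfl⟩ := hm
  have : l = [] := by
    by_contra hl
    exact hfl (Pi.single_eq_of_ne hl _)
  simpa [this] using hx l hl hfl

lemma magnusSeries_injective : Function.Injective (magnusSeries (α := α)) := by
  intro g h hgh
  have : magnusSeries (h⁻¹ * g) = Pi.single [] 1 := by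
    have h1 : magnusSeries (h⁻¹ * g) = magnus h⁻¹ (magnusSeries g) := by simp [magnusSeries]
    rw [h1, hgh]
    simp [magnusSeries, ← LinearEquiv.mul_apply]
  exact (inv_mul_eq_one.1 (eq_one_of_magnusSeries_eq this)).symm

end Order

/-- A free group carries a total order invariant under conjugation. -/
lemma exists_conj_invariant_lt (α : Type*) : ∃ r : FreeGroup α → FreeGroup α → Prop,
    IsStrictTotalOrder _ r ∧ ∀ x g h, r g h → r (x * g * x⁻¹) (x * h * x⁻¹) := by
  classical
  obtain ⟨_, hwf⟩ := exists_wellFoundedLT (α := α)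
  have hwf' := List.Shortlex.wf (wellFounded_lt (α := α))
  have hshort : IsTrans _ (List.Shortlex (· < · : α → α → Prop)) := by
    refine ⟨fun a b c hab hbc ↦ ?_⟩
    rcases trichotomous_of (List.Shortlex (· < ·)) a c with h | rfl | h
    · exact h
    · exact (hwf'.asymmetric _ _ hab hbc).elim
    · exact (hwf'.asymmetric₃ _ _ _ hab hbc h).elim
  have hlen {t l : List α} (h : t.length < l.length) : List.Shortlex (· < ·) t l :=
    .of_length_lt h
  let r (g h : FreeGroup α) : Prop :=
    Pi.Lex (List.Shortlex (· < ·)) (· < ·) (magnusSeries g) (magnusSeries h)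
  have htri := Pi.trichotomous_lex (β := fun _ : List α ↦ ℤ) (List.Shortlex (· < ·))
    (fun {_} ↦ (· < ·)) hwf'
  have hirr : Std.Irrefl r := ⟨fun g ⟨l, _, hl⟩ ↦ lt_irrefl _ hl⟩
  have htrans : IsTrans _ r := by
    refine ⟨fun g h k ⟨l, hl, hl'⟩ ⟨m, hm, hm'⟩ ↦ ?_⟩
    rcases trichotomous_of (List.Shortlex (· < ·)) l m with hlm | rfl | hml
    · exact ⟨l, fun t ht ↦ (hl t ht).trans (hm t (_root_.trans ht hlm)), (hm l hlm) ▸ hl'⟩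
    · exact ⟨l, fun t ht ↦ (hl t ht).trans (hm t ht), hl'.trans hm'⟩
    · exact ⟨m, fun t ht ↦ (hl t (_root_.trans ht hml)).trans (hm t ht), (hl m hml).symm ▸ hm'⟩
  have htri' : Std.Trichotomous r := by
    refine ⟨fun g h h1 h2 ↦ magnusSeries_injective (htri.trichotomous _ _ h1 h2)⟩
  have step (S : (List α → ℤ) → List α → ℤ) (hS : ∀ f f' l,
      (∀ t : List α, t.length < l.length → f t = f' t) → S f l = S f' l) (φ : FreeGroup α →
      FreeGroup α) (hφ : ∀ g, magnusSeries (φ g) = magnusSeries g + S (magnusSeries g)) (g h)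
      (hgh : r g h) : r (φ g) (φ h) := by
    obtain ⟨l, hl, hl'⟩ := hgh
    refine ⟨l, fun t ht ↦ ?_, ?_⟩
    · rw [hφ, hφ, Pi.add_apply, Pi.add_apply, hl t ht,
        hS _ _ t fun s hs ↦ hl s (_root_.trans (hlen hs) ht)]
    · rw [hφ, hφ, Pi.add_apply, Pi.add_apply, hS _ _ l fun s hs ↦ hl s (hlen hs)]
      simpa using hl'
  refine ⟨r, { hirr, htrans, htri' with }, fun x ↦ ?_⟩
  induction x using FreeGroup.induction_on with
  | C1 => simp
  | of x =>
    refine step (fun f ↦ -magnusRight x f + magnusLeft x (f - magnusRight x f))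
      (fun f f' l h ↦ ?_) _ fun g ↦ ?_
    · have h1 := magnusRight_congr x h
      have h2 : magnusLeft x (f - magnusRight x f) l = magnusLeft x (f' - magnusRight x f') l :=
        magnusLeft_congr x fun t ht ↦ by
          simp [h t ht, magnusRight_congr x fun s hs ↦ h s (hs.trans ht)]
      rw [Pi.add_apply, Pi.add_apply, Pi.neg_apply, Pi.neg_apply, h1, h2]
    · rw [magnusSeries_conj]
      abel
  | inv_of x _ =>
    refine step (fun f ↦ magnusRight x f - magnusLeft x (f + magnusRight x f))
      (fun f f' l h ↦ ?_) _ fun g ↦ ?_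
    · have h1 := magnusRight_congr x h
      have h2 : magnusLeft x (f + magnusRight x f) l = magnusLeft x (f' + magnusRight x f') l :=
        magnusLeft_congr x fun t ht ↦ by
          simp [h t ht, magnusRight_congr x fun s hs ↦ h s (hs.trans ht)]
      rw [Pi.sub_apply, Pi.sub_apply, h1, h2]
    · rw [inv_inv, magnusSeries_conj_inv]
      abel
  | mul a b ha hb =>
    intro g h hr
    simpa [mul_assoc] using ha _ _ (hb _ _ hr)

end FreeGroup

namespace FreeGroup

section Loops

variable {α V : Type*} {ℓ : ℕ} (l : ZMod ℓ → α × Bool)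

/-- The end of the `i`-th edge of a cyclic word at which the traversed generator starts. -/
def baseIdx (i : ZMod ℓ) : ZMod ℓ := if (l i).2 then i else i + 1

/-- The end of the `i`-th edge of a cyclic word at which the traversed generator stops. -/
def tipIdx (i : ZMod ℓ) : ZMod ℓ := if (l i).2 then i + 1 else i

/-- The `i`-th edge of the closed path `y`, in the graph whose edge `(v, a)` joins `v` to
`a⁻¹ • v`. -/
def loopEdge (y : ZMod ℓ → V) (i : ZMod ℓ) : V × α := (y (baseIdx l i), (l i).1)

/-- `y` is a closed path reading the cyclic word `l`. -/
def IsLoop [MulAction (FreeGroup α) V] (y : ZMod ℓ → V) : Prop :=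
  ∀ i, y (tipIdx l i) = (of (l i).1)⁻¹ • y (baseIdx l i)

/-- The cyclic word `l` is cyclically reduced. -/
def CycReduced : Prop := ∀ i, (l (i + 1)).1 = (l i).1 → (l (i + 1)).2 = (l i).2

variable {l}

lemma eq_of_baseIdx_eq (hl : CycReduced l) {i j : ZMod ℓ} (hij : baseIdx l i = baseIdx l j)
    (ha : (l i).1 = (l j).1) : i = j := by
  unfold baseIdx at hij
  split_ifs at hij with h1 h2 h2
  · exact hij
  · subst hij
    exact absurd ((hl j) ha ▸ h1) h2
  · subst hij
    exact absurd ((hl i) ha.symm ▸ h2) h1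
  · exact add_right_cancel hij

lemma eq_of_tipIdx_eq (hl : CycReduced l) {i j : ZMod ℓ} (hij : tipIdx l i = tipIdx l j)
    (ha : (l i).1 = (l j).1) : i = j := by
  unfold tipIdx at hij
  split_ifs at hij with h1 h2 h2
  · exact add_right_cancel hij
  · subst hij
    exact absurd ((hl i) ha.symm ▸ h1) h2
  · subst hij
    exact absurd ((hl j) ha ▸ h2) h1
  · exact hij

variable [MulAction (FreeGroup α) V]

lemma IsLoop.tip_eq {y y' : ZMod ℓ → V} (hy : IsLoop l y) (hy' : IsLoop l y') {i j : ZMod ℓ}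
    (h : loopEdge l y i = loopEdge l y' j) : y (tipIdx l i) = y' (tipIdx l j) := by
  have h1 : y (baseIdx l i) = y' (baseIdx l j) := congrArg Prod.fst h
  have h2 : (l i).1 = (l j).1 := congrArg Prod.snd h
  rw [hy i, hy' j, h1, h2]

lemma IsLoop.step {y y' : ZMod ℓ → V} (hy : IsLoop l y) (hy' : IsLoop l y') (i : ZMod ℓ) :
    y (i + 1) = y' (i + 1) ↔ y i = y' i := by
  have h := hy i
  have h' := hy' i
  unfold tipIdx baseIdx at h h'
  split_ifs at h h' with hi
  · rw [h, h']
    simp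
  · rw [h, h']
    simp

lemma IsLoop.ext [NeZero ℓ] {y y' : ZMod ℓ → V} (hy : IsLoop l y) (hy' : IsLoop l y')
    (i : ZMod ℓ) (h : y i = y' i) : y = y' := by
  have key (k : ℕ) : y (i + k) = y' (i + k) := by
    induction k with
    | zero => simpa using h
    | succ k ih => rwa [Nat.cast_succ, ← add_assoc, hy.step hy']
  funext j
  simpa using key (j - i).val

open Finset in
/-- The Louder–Wilton counting inequality: if every edge of the union of a finite set of closed
paths is traversed at least twice, then this union has large rank. -/
lemma card_loops_add_card_le [NeZero ℓ] [DecidableEq V] [DecidableEq α] (hl : CycReduced l)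
    {ρ : ZMod ℓ → FreeGroup α} (hinj : Function.Injective ρ)
    (hρ : ∀ i, ρ (tipIdx l i) = (of (l i).1)⁻¹ * ρ (baseIdx l i) * of (l i).1)
    (Q : Finset (ZMod ℓ → V)) (hQ : ∀ y ∈ Q, IsLoop l y)
    (hdbl : ∀ y ∈ Q, ∀ i, ∃ y' ∈ Q, ∃ j, loopEdge l y' j = loopEdge l y i ∧ ¬(y' = y ∧ j = i)) :
    #Q + #((Q ×ˢ univ).image fun t : (ZMod ℓ → V) × ZMod ℓ ↦ t.1 t.2) ≤
      #((Q ×ˢ univ).image fun t : (ZMod ℓ → V) × ZMod ℓ ↦ loopEdge l t.1 t.2) := by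
  classical
  obtain ⟨r, hr, hconj⟩ := exists_conj_invariant_lt α
  let _ : LinearOrder (FreeGroup α) := linearOrderOfSTO r
  have hconj' (x : FreeGroup α) {g h : FreeGroup α} (hgh : x⁻¹ * g * x ≤ x⁻¹ * h * x) :
      g ≤ h := by
    by_contra hlt
    have := hconj x⁻¹ _ _ (not_le.1 hlt)
    rw [inv_inv] at this
    exact not_lt.2 hgh this
  let T : Finset ((ZMod ℓ → V) × ZMod ℓ) := Q ×ˢ univ
  let TV := T.filter fun t ↦ ∀ t' ∈ T, t'.1 t'.2 = t.1 t.2 → ρ t'.2 ≤ ρ t.2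
  let TE := T.filter fun t ↦ ∀ t' ∈ T, loopEdge l t'.1 t'.2 = loopEdge l t.1 t.2 →
    ρ (baseIdx l t'.2) ≤ ρ (baseIdx l t.2)
  have hmemT (t) : t ∈ T ↔ t.1 ∈ Q := by simp [T]
  have base_ext {t t'} (ht : t ∈ T) (ht' : t' ∈ T)
      (h : loopEdge l t.1 t.2 = loopEdge l t'.1 t'.2)
      (h' : baseIdx l t.2 = baseIdx l t'.2) : t = t' := by
    have h1 := congrArg Prod.fst h
    have h2 := eq_of_baseIdx_eq hl h' (congrArg Prod.snd h)
    refine Prod.ext ?_ h2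
    exact (hQ _ ((hmemT t).1 ht)).ext (hQ _ ((hmemT t').1 ht')) (baseIdx l t.2)
      (by simpa [loopEdge, h'] using h1)
  have tip_ext {t t'} (ht : t ∈ T) (ht' : t' ∈ T)
      (h : loopEdge l t.1 t.2 = loopEdge l t'.1 t'.2)
      (h' : tipIdx l t.2 = tipIdx l t'.2) : t = t' :=
    base_ext ht ht' h (by rw [eq_of_tipIdx_eq hl h' (congrArg Prod.snd h)])
  have hE : #TE ≤ #(T.image fun t ↦ loopEdge l t.1 t.2) := by
    refine card_le_card_of_injOn (fun t ↦ loopEdge l t.1 t.2) ?_ ?_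
    · intro t ht
      exact mem_image_of_mem _ (filter_subset _ _ ht)
    · intro t ht t' ht' h
      simp only [TE, mem_coe, mem_filter] at ht ht'
      exact base_ext ht.1 ht'.1 h
        (hinj (le_antisymm (ht'.2 t ht.1 h) (ht.2 t' ht'.1 h.symm)))
  have hV : #(T.image fun t ↦ t.1 t.2) ≤ #TV := by
    have hsub : T.image (fun t ↦ t.1 t.2) ⊆ TV.image fun t ↦ t.1 t.2 := by
      intro v hv
      obtain ⟨t₀, ht₀, rfl⟩ := mem_image.1 hv
      obtain ⟨t, ht, hmax⟩ := exists_max_image (T.filter fun t ↦ t.1 t.2 = t₀.1 t₀.2)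
        (fun t ↦ ρ t.2) ⟨t₀, by simp [ht₀]⟩
      simp only [mem_filter] at ht hmax
      refine mem_image.2 ⟨t, ?_, ht.2⟩
      simp only [TV, mem_filter]
      exact ⟨ht.1, fun t' ht' h ↦ hmax t' ⟨ht', h.trans ht.2⟩⟩
    exact (card_le_card hsub).trans card_image_le
  have base_mem {t} (ht : (t.1, baseIdx l t.2) ∈ TV) : t ∈ TE := by
    simp only [TV, TE, mem_filter, hmemT] at ht ⊢
    exact ⟨ht.1, fun t' ht' h ↦ ht.2 (t'.1, baseIdx l t'.2) ht' (congrArg Prod.fst h)⟩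
  have tip_mem {t} (ht : (t.1, tipIdx l t.2) ∈ TV) : t ∈ TE := by
    simp only [TV, TE, mem_filter, hmemT] at ht ⊢
    refine ⟨ht.1, fun t' ht' h ↦ ?_⟩
    have := ht.2 (t'.1, tipIdx l t'.2) ht' ((hQ _ ht').tip_eq (hQ _ ht.1) h)
    simp only [hρ] at this
    have h2 : (l t'.2).1 = (l t.2).1 := congrArg Prod.snd h
    rw [h2] at this
    exact hconj' _ this
  have mem_or (i : ZMod ℓ) : (baseIdx l i = i ∧ tipIdx l i = i + 1) ∨
      (tipIdx l i = i ∧ baseIdx l i = i + 1) := by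
    unfold baseIdx tipIdx
    split_ifs <;> simp
  have mem_left {y i} (h : (y, i) ∈ TV) : (y, i) ∈ TE := by
    rcases mem_or i with hi | hi
    · exact base_mem (t := (y, i)) (by rwa [hi.1])
    · exact tip_mem (t := (y, i)) (by rwa [hi.1])
  have mem_right {y i} (h : (y, i + 1) ∈ TV) : (y, i) ∈ TE := by
    rcases mem_or i with hi | hi
    · exact tip_mem (t := (y, i)) (by rwa [hi.2])
    · exact base_mem (t := (y, i)) (by rwa [hi.2])
  have hex (y) (hy : y ∈ Q) : ∃ i, (y, i) ∈ TE ∧ (y, i + 1) ∉ TV := by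
    by_contra! hcon
    obtain ⟨i₁, -, hi₁⟩ := exists_max_image univ ρ univ_nonempty
    obtain ⟨i₀, -, hi₀⟩ := exists_min_image univ ρ univ_nonempty
    have hmem (k : ℕ) : (y, i₁ + k) ∈ TV := by
      induction k with
      | zero =>
        simp only [TV, mem_filter, hmemT]
        exact ⟨hy, fun t' _ _ ↦ by simpa using hi₁ t'.2 (mem_univ _)⟩
      | succ k ih =>
        rw [Nat.cast_succ, ← add_assoc]
        exact hcon _ (mem_left ih)
    have hTV : (y, i₀) ∈ TV := by simpa using hmem (i₀ - i₁).val
    obtain ⟨y', hy', j, hedge, hne⟩ := hdbl y hy i₀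
    simp only [TV, mem_filter, hmemT] at hTV
    have hne' : (y', j) ≠ (y, i₀) := by simpa using hne
    rcases mem_or i₀ with hi | hi
    · refine hne' (base_ext ((hmemT _).2 hy') ((hmemT _).2 hy) hedge (hinj ?_))
      have h1 : y' (baseIdx l j) = y i₀ := by
        have := congrArg Prod.fst hedge
        rwa [loopEdge, loopEdge, hi.1] at this
      simp only [hi.1]
      exact le_antisymm (hTV.2 (y', baseIdx l j) hy' h1) (hi₀ _ (mem_univ _))
    · refine hne' (tip_ext ((hmemT _).2 hy') ((hmemT _).2 hy) hedge (hinj ?_))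
      have h1 : y' (tipIdx l j) = y i₀ := by
        have := (hQ _ hy').tip_eq (hQ _ hy) hedge
        rwa [hi.1] at this
      simp only [hi.1]
      exact le_antisymm (hTV.2 (y', tipIdx l j) hy' h1) (hi₀ _ (mem_univ _))
  choose! i hiTE hiTV using hex
  have hcard : #Q + #TV ≤ #TE := by
    rw [← card_image_of_injective Q (f := fun y ↦ (y, i y)) fun y y' h ↦ (Prod.ext_iff.1 h).1,
      ← card_image_of_injective TV (f := fun t ↦ (t.1, t.2 - 1))
        fun t t' h ↦ by simpa [Prod.ext_iff] using h, ← card_union_of_disjoint]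
    · refine card_le_card (union_subset ?_ ?_)
      · exact image_subset_iff.2 hiTE
      · exact image_subset_iff.2 fun t ht ↦ mem_right (by simpa using ht)
    · simp only [disjoint_left, mem_image, not_exists, not_and]
      rintro _ ⟨y, hy, rfl⟩ t ht h
      obtain ⟨h1, h2⟩ := Prod.ext_iff.1 h
      simp only at h1 h2
      refine hiTV y hy ?_
      rw [← h2, ← h1]
      simpa using ht
  exact (Nat.add_le_add_left hV _).trans (hcard.trans hE)

end Loops

end FreeGroup

namespace FreeGroup

section Cochains

variable {α V A : Type*} {ℓ : ℕ} (l : ZMod ℓ → α × Bool)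

/-- The sum of a cochain along a closed path. -/
def loopSum [NeZero ℓ] [AddCommGroup A] (c : V × α → A) (y : ZMod ℓ → V) : A :=
  ∑ i, if (l i).2 then c (loopEdge l y i) else -c (loopEdge l y i)

variable {l}

lemma loopSum_congr [NeZero ℓ] [AddCommGroup A] {c c' : V × α → A} {y : ZMod ℓ → V}
    (h : ∀ i, c (loopEdge l y i) = c' (loopEdge l y i)) : loopSum l c y = loopSum l c' y :=
  Finset.sum_congr rfl fun i _ ↦ by rw [h]

lemma loopSum_update [NeZero ℓ] [AddCommGroup A] [DecidableEq V] [DecidableEq α]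
    (c : V × α → A) (y : ZMod ℓ → V) (i₀ : ZMod ℓ)
    (h : ∀ i, loopEdge l y i = loopEdge l y i₀ → i = i₀) :
    ∃ t, loopSum l (Function.update c (loopEdge l y i₀) t) y = 0 := by
  classical
  let s := ∑ i ∈ Finset.univ.erase i₀, if (l i).2 then c (loopEdge l y i) else -c (loopEdge l y i)
  refine ⟨if (l i₀).2 then -s else s, ?_⟩
  rw [loopSum, ← Finset.add_sum_erase _ _ (Finset.mem_univ i₀)]
  have : ∀ i ∈ Finset.univ.erase i₀,
      Function.update c (loopEdge l y i₀) (if (l i₀).2 then -s else s) (loopEdge l y i) =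
        c (loopEdge l y i) := fun i hi ↦
    Function.update_of_ne (fun h' ↦ Finset.ne_of_mem_erase hi (h i h')) _ _
  rw [Finset.sum_congr rfl fun i hi ↦ by rw [this i hi], Function.update_self]
  change _ + s = 0
  split_ifs <;> simp

variable [MulAction (FreeGroup α) V]

lemma finite_loops [NeZero ℓ] (E : Finset (V × α)) :
    {y : ZMod ℓ → V | IsLoop l y ∧ ∀ i, loopEdge l y i ∈ E}.Finite := by
  refine Set.Finite.of_finite_image (f := loopEdge l)
    ((Set.Finite.pi' fun _ ↦ E.finite_toSet).subset (t := _) ?_) ?_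
  · rintro _ ⟨y, hy, rfl⟩ i
    exact hy.2 i
  · intro y hy y' hy' h
    exact hy.1.ext hy'.1 _ (congrArg Prod.fst (congrFun h 0))

open Finset in
lemma exists_equivariant_aux [NeZero ℓ] [DecidableEq V] [DecidableEq α] (hl : CycReduced l)
    {ρ : ZMod ℓ → FreeGroup α} (hinj : Function.Injective ρ)
    (hρ : ∀ i, ρ (tipIdx l i) = (of (l i).1)⁻¹ * ρ (baseIdx l i) * of (l i).1)
    (E : Finset (V × α)) (Q : Finset (ZMod ℓ → V))
    (hQ : ∀ y, y ∈ Q ↔ IsLoop l y ∧ ∀ i, loopEdge l y i ∈ E)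
    (hE : ∀ c : V × α → ℚ, (∀ y ∈ Q, loopSum l c y = 0) →
      ∃ f : V → ℚ, ∀ e ∈ E, c e = f ((of e.2)⁻¹ • e.1) - f e.1)
    (hdbl : ∀ y ∈ Q, ∀ i, ∃ y' ∈ Q, ∃ j, loopEdge l y' j = loopEdge l y i ∧ ¬(y' = y ∧ j = i))
    (hcov : ∀ e ∈ E, ∃ y ∈ Q, ∃ i, loopEdge l y i = e) : E = ∅ := by
  by_contra hne
  obtain ⟨e₀, he₀⟩ := nonempty_iff_ne_empty.2 hne
  have hcount := card_loops_add_card_le hl hinj hρ Q (fun y hy ↦ ((hQ y).1 hy).1) hdbl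
  set W := (Q ×ˢ univ).image fun t : (ZMod ℓ → V) × ZMod ℓ ↦ t.1 t.2 with hW
  have hEim : (Q ×ˢ univ).image (fun t : (ZMod ℓ → V) × ZMod ℓ ↦ loopEdge l t.1 t.2) ⊆ E :=
    image_subset_iff.2 fun t ht ↦ ((hQ t.1).1 (mem_product.1 ht).1).2 t.2
  replace hcount := hcount.trans (card_le_card hEim)
  have hmemW {y} (hy : y ∈ Q) (i) : y i ∈ W := mem_image.2 ⟨(y, i), by simp [hy], rfl⟩
  have hbase (e : E) : e.1.1 ∈ W := by
    obtain ⟨y, hy, i, hi⟩ := hcov e.1 e.2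
    rw [← hi]
    exact hmemW hy _
  have htip (e : E) : (of e.1.2)⁻¹ • e.1.1 ∈ W := by
    obtain ⟨y, hy, i, hi⟩ := hcov e.1 e.2
    rw [← hi, loopEdge, ← ((hQ y).1 hy).1 i]
    exact hmemW hy _
  let L : (E → ℚ) →ₗ[ℚ] (Q → ℚ) := LinearMap.pi fun y ↦
    ∑ i, (if (l i).2 then (1 : ℚ) else -1) • LinearMap.proj ⟨loopEdge l y.1 i, ((hQ y).1 y.2).2 i⟩
  let D : (W → ℚ) →ₗ[ℚ] (E → ℚ) := LinearMap.pi fun e ↦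
    LinearMap.proj ⟨_, htip e⟩ - LinearMap.proj ⟨_, hbase e⟩
  have hLD : LinearMap.ker L ≤ LinearMap.range D := by
    intro c hc
    obtain ⟨f, hf⟩ := hE (fun e ↦ if h : e ∈ E then c ⟨e, h⟩ else 0) fun y hy ↦ by
      have := congrFun (LinearMap.mem_ker.1 hc) ⟨y, hy⟩
      rw [← this.trans (Pi.zero_apply _)]
      simp only [L, LinearMap.pi_apply, LinearMap.sum_apply, loopSum, LinearMap.smul_apply,
        LinearMap.proj_apply]
      refine sum_congr rfl fun i _ ↦ ?_
      rw [dif_pos (((hQ y).1 hy).2 i)]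
      split_ifs <;> simp
    refine ⟨fun v ↦ f v.1, funext fun e ↦ ?_⟩
    have := hf e.1 e.2
    rw [dif_pos e.2] at this
    simp [D, this]
  have hD : 0 < Module.finrank ℚ (LinearMap.ker D) := by
    rw [Module.finrank_pos_iff_exists_ne_zero]
    refine ⟨⟨fun _ ↦ 1, ?_⟩, fun h ↦ ?_⟩
    · rw [LinearMap.mem_ker]
      ext e
      simp [D]
    · have := congrFun (congrArg Subtype.val h) ⟨_, hbase ⟨e₀, he₀⟩⟩
      simp at this
  have h1 := LinearMap.finrank_range_add_finrank_ker L
  have h2 := LinearMap.finrank_range_add_finrank_ker D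
  have h3 := Submodule.finrank_mono hLD
  have h4 := (LinearMap.range L).finrank_le
  simp only [Module.finrank_fintype_fun_eq_card, Fintype.card_coe] at h1 h2 h4
  omega

open Finset in
/-- If every rational cochain on a finite set of edges vanishing along closed paths is a
coboundary, then the covering this set generates is trivial over `π`. -/
lemma exists_equivariant [NeZero ℓ] (hl : CycReduced l)
    {ρ : ZMod ℓ → FreeGroup α} (hinj : Function.Injective ρ)
    (hρ : ∀ i, ρ (tipIdx l i) = (of (l i).1)⁻¹ * ρ (baseIdx l i) * of (l i).1)
    {Γ : Type*} [Group Γ] (π : FreeGroup α →* Γ)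
    (hπ : ∀ (z : ZMod ℓ → Γ) (i₀ : ZMod ℓ),
      (∀ i ≠ i₀, z (tipIdx l i) = (π (of (l i).1))⁻¹ * z (baseIdx l i)) →
      z (tipIdx l i₀) = (π (of (l i₀).1))⁻¹ * z (baseIdx l i₀))
    (E : Finset (V × α))
    (hE : ∀ c : V × α → ℚ,
      (∀ y, IsLoop l y → (∀ i, loopEdge l y i ∈ E) → loopSum l c y = 0) →
      ∃ f : V → ℚ, ∀ e ∈ E, c e = f ((of e.2)⁻¹ • e.1) - f e.1) :
    ∃ φ : V → Γ, ∀ e ∈ E, φ ((of e.2)⁻¹ • e.1) = (π (of e.2))⁻¹ * φ e.1 := by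
  classical
  induction E using Finset.strongInduction with
  | H E ih =>
  by_cases h1 : ∃ e ∈ E, ∀ y, IsLoop l y → (∀ i, loopEdge l y i ∈ E) → ∀ i, loopEdge l y i ≠ e
  · obtain ⟨e, he, hne⟩ := h1
    obtain ⟨φ, hφ⟩ := ih _ (erase_ssubset he) fun c hc ↦ by
      obtain ⟨f, hf⟩ := hE c fun y hy hyE ↦
        hc y hy fun i ↦ mem_erase.2 ⟨hne y hy hyE i, hyE i⟩
      exact ⟨f, fun e he ↦ hf e (mem_of_mem_erase he)⟩
    obtain ⟨f, hf⟩ := hE (Pi.single e 1) fun y hy hyE ↦ by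
      rw [loopSum_congr (c' := 0) fun i ↦ Pi.single_eq_of_ne (hne y hy hyE i) _]
      simp [loopSum]
    refine ⟨fun u ↦ φ u *
      if f u = f e.1 then (φ e.1)⁻¹ * π (of e.2) * φ ((of e.2)⁻¹ • e.1) else 1, fun e' he' ↦ ?_⟩
    have hfe := hf e' he'
    beta_reduce
    by_cases hee : e' = e
    · subst hee
      rw [Pi.single_eq_same] at hfe
      rw [if_neg (by intro h; rw [h] at hfe; simp at hfe), if_pos rfl]
      group
    · rw [Pi.single_eq_of_ne hee, eq_comm, sub_eq_zero] at hfe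
      rw [hfe, hφ e' (mem_erase.2 ⟨hee, he'⟩), mul_assoc]
  by_cases h2 : ∃ y, (IsLoop l y ∧ ∀ i, loopEdge l y i ∈ E) ∧ ∃ i, ∀ y' j, IsLoop l y' →
      (∀ i, loopEdge l y' i ∈ E) → loopEdge l y' j = loopEdge l y i → y' = y ∧ j = i
  · obtain ⟨y, ⟨hy, hyE⟩, i, huniq⟩ := h2
    obtain ⟨φ, hφ⟩ := ih _ (erase_ssubset (hyE i)) fun c hc ↦ by
      obtain ⟨t, ht⟩ := loopSum_update c y i fun j h ↦ (huniq y j hy hyE h).2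
      obtain ⟨f, hf⟩ := hE (Function.update c (loopEdge l y i) t) fun y' hy' hyE' ↦ by
        by_cases hyy : y' = y
        · rwa [hyy]
        · have hne (j) : loopEdge l y' j ≠ loopEdge l y i :=
            fun h ↦ hyy (huniq y' j hy' hyE' h).1
          rw [loopSum_congr fun j ↦ Function.update_of_ne (hne j) _ _]
          exact hc y' hy' fun j ↦ mem_erase.2 ⟨hne j, hyE' j⟩
      refine ⟨f, fun e he ↦ ?_⟩
      rw [← hf e (mem_of_mem_erase he), Function.update_of_ne (ne_of_mem_erase he)]
    refine ⟨φ, fun e he ↦ ?_⟩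
    by_cases hee : e = loopEdge l y i
    · subst hee
      rw [loopEdge, ← hy i]
      refine hπ (φ ∘ y) i fun j hj ↦ ?_
      have := hφ (loopEdge l y j)
        (mem_erase.2 ⟨fun h ↦ hj (huniq y j hy hyE h).2, hyE j⟩)
      rwa [loopEdge, ← hy j] at this
    · exact hφ e (mem_erase.2 ⟨hee, he⟩)
  · have : E = ∅ := by
      refine exists_equivariant_aux hl hinj hρ E (finite_loops (l := l) E).toFinset (by simp)
        (fun c hc ↦ hE c fun y hy hyE ↦ hc y (by simp [hy, hyE])) ?_ ?_
      · push Not at h2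
        intro y hy i
        obtain ⟨y', j, h1, h2, h3, h4⟩ := h2 y (by simpa using hy) i
        exact ⟨y', by simp [h1, h2], j, h3, fun h ↦ h4 h.1 h.2⟩
      · push Not at h1
        intro e he
        obtain ⟨y, hy, hyE, i, hi⟩ := h1 e he
        exact ⟨y, by simp [hy, hyE], i, hi⟩
    subst this
    exact ⟨fun _ ↦ 1, by simp⟩

end Cochains

end FreeGroup

namespace FreeGroup

section CyclicWords

variable {α : Type*} {ℓ : ℕ} (l : ZMod ℓ → α × Bool)

/-- The element read along the first `k` letters of the cyclic word `l`, starting at `i`. -/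
def cycProd (i : ZMod ℓ) (k : ℕ) : FreeGroup α := mk ((List.range k).map fun j : ℕ ↦ l (i + j))

@[simp] lemma cycProd_zero (i : ZMod ℓ) : cycProd l i 0 = 1 := rfl

lemma cycProd_succ (i : ZMod ℓ) (k : ℕ) :
    cycProd l i (k + 1) = cycProd l i k * mk [l (i + k)] := by
  simp [cycProd, List.range_succ]

lemma cycProd_succ' (i : ZMod ℓ) (k : ℕ) :
    cycProd l i (k + 1) = mk [l i] * cycProd l (i + 1) k := by
  simp [cycProd, List.range_succ_eq_map, Function.comp_def, add_assoc, add_comm (1 : ZMod ℓ)]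

lemma cycProd_add (i : ZMod ℓ) (k m : ℕ) :
    cycProd l i (k + m) = cycProd l i k * cycProd l (i + k) m := by
  induction m with
  | zero => simp
  | succ m ih => rw [← add_assoc, cycProd_succ, ih, cycProd_succ, mul_assoc]; simp [add_assoc]

lemma cycProd_add_one (i : ZMod ℓ) :
    cycProd l (i + 1) ℓ = (mk [l i])⁻¹ * cycProd l i ℓ * mk [l i] := by
  rw [eq_comm, mul_assoc, inv_mul_eq_iff_eq_mul, ← cycProd_succ', cycProd_succ]
  simp

lemma mk_singleton_eq (p : α × Bool) : mk [p] = if p.2 then of p.1 else (of p.1)⁻¹ := by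
  obtain ⟨a, b⟩ := p
  cases b <;> simp [of, invRev]

lemma step_iff {X Γ : Type*} [Group Γ] [MulAction Γ X] (π : FreeGroup α →* Γ) (z : ZMod ℓ → X)
    (i : ZMod ℓ) : z (tipIdx l i) = (π (of (l i).1))⁻¹ • z (baseIdx l i) ↔
      z (i + 1) = (π (mk [l i]))⁻¹ • z i := by
  rw [mk_singleton_eq]
  unfold tipIdx baseIdx
  split_ifs
  · rfl
  · rw [_root_.map_inv, inv_inv, eq_inv_smul_iff, eq_comm]

variable {l}

lemma isLoop_iff {V : Type*} [MulAction (FreeGroup α) V] {y : ZMod ℓ → V} :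
    IsLoop l y ↔ ∀ i, y (i + 1) = (mk [l i])⁻¹ • y i :=
  forall_congr' fun i ↦ step_iff l (MonoidHom.id _) y i

lemma cycProd_tipIdx (i : ZMod ℓ) :
    cycProd l (tipIdx l i) ℓ = (of (l i).1)⁻¹ * cycProd l (baseIdx l i) ℓ * of (l i).1 := by
  have := (step_iff (X := FreeGroup α) (Γ := ConjAct (FreeGroup α)) l
    ConjAct.toConjAct.toMonoidHom (fun i ↦ cycProd l i ℓ) i).2
    (by simp [cycProd_add_one, ConjAct.smul_def])
  simpa [ConjAct.smul_def] using this

lemma IsLoop.apply_add {V : Type*} [MulAction (FreeGroup α) V] {y : ZMod ℓ → V}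
    (hy : IsLoop l y) (i : ZMod ℓ) (k : ℕ) : y (i + k) = (cycProd l i k)⁻¹ • y i := by
  induction k with
  | zero => simp
  | succ k ih =>
    rw [Nat.cast_succ, ← add_assoc, isLoop_iff.1 hy, ih, cycProd_succ, mul_inv_rev, mul_smul]

lemma exists_isLoop [NeZero ℓ] {V : Type*} [MulAction (FreeGroup α) V] {v : V}
    (hv : cycProd l 0 ℓ • v = v) : ∃ y : ZMod ℓ → V, IsLoop l y ∧ y 0 = v := by
  refine ⟨fun i ↦ (cycProd l 0 i.val)⁻¹ • v, isLoop_iff.2 fun i ↦ ?_, by simp⟩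
  have h := cycProd_succ l 0 i.val
  rw [ZMod.natCast_zmod_val, zero_add] at h
  rw [smul_smul, ← mul_inv_rev, ← h]
  have hval : (i + 1).val = (i.val + 1) % ℓ := by
    rw [ZMod.val_add, ZMod.val_one_eq_one_mod, Nat.add_mod_mod]
  rcases (Nat.succ_le_of_lt i.val_lt).lt_or_eq with hi | hi
  · rw [hval, Nat.mod_eq_of_lt hi]
  · rw [hval, ← Nat.succ_eq_add_one, hi, Nat.mod_self, cycProd_zero, inv_one, one_smul,
      eq_inv_smul_iff, hv]

lemma relation_of_forall_ne [NeZero ℓ] {Γ : Type*} [Group Γ] (π : FreeGroup α →* Γ)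
    (hπ : π (cycProd l 0 ℓ) = 1) (z : ZMod ℓ → Γ) (i₀ : ZMod ℓ)
    (h : ∀ i ≠ i₀, z (tipIdx l i) = (π (of (l i).1))⁻¹ * z (baseIdx l i)) :
      z (tipIdx l i₀) = (π (of (l i₀).1))⁻¹ * z (baseIdx l i₀) := by
  have hπ' (k : ℕ) : π (cycProd l k ℓ) = 1 := by
    induction k with
    | zero => simpa using hπ
    | succ k ih => rw [Nat.cast_succ, cycProd_add_one, _root_.map_mul, _root_.map_mul, ih, mul_one,
      ← _root_.map_mul, inv_mul_cancel, _root_.map_one]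
  have key (k : ℕ) (hk : k < ℓ) : z (i₀ + 1 + k) = (π (cycProd l (i₀ + 1) k))⁻¹ * z (i₀ + 1) := by
    induction k with
    | zero => simp
    | succ k ih =>
      have hne : i₀ + 1 + (k : ZMod ℓ) ≠ i₀ := by
        intro h
        have h1 : ((k + 1 : ℕ) : ZMod ℓ) = 0 := by
          push_cast
          linear_combination h
        rw [ZMod.natCast_eq_zero_iff] at h1
        exact absurd (Nat.le_of_dvd (by omega) h1) (by omega)
      have := (step_iff l π z _).1 (h _ hne)
      rw [Nat.cast_succ, ← add_assoc, this, ih (by omega), cycProd_succ, smul_eq_mul]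
      simp [mul_assoc]
  refine (step_iff l π z i₀).2 ?_
  obtain ⟨m, hm⟩ : ∃ m, ℓ = m + 1 := Nat.exists_eq_succ_of_ne_zero (NeZero.ne ℓ)
  have h1 := key m (by omega)
  have h2 : i₀ + 1 + (m : ZMod ℓ) = i₀ := by
    have : ((m + 1 : ℕ) : ZMod ℓ) = 0 := by rw [← hm]; simp
    push_cast at this
    linear_combination this
  rw [h2] at h1
  have h3 := hπ' i₀.val
  rw [ZMod.natCast_zmod_val] at h3
  have h4 : cycProd l i₀ ℓ = mk [l i₀] * cycProd l (i₀ + 1) m := by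
    rw [← cycProd_succ', ← hm]
  rw [h4, _root_.map_mul] at h3
  rw [h1, smul_eq_mul, ← mul_assoc, ← mul_inv_rev, mul_eq_one_iff_eq_inv.1 h3]
  simp

lemma isReduced_cycWord (hl : CycReduced l) (i : ZMod ℓ) (k : ℕ) :
    IsReduced ((List.range k).map fun j : ℕ ↦ l (i + j)) := by
  rw [IsReduced, List.isChain_map]
  cases k with
  | zero => simp
  | succ k =>
    rw [List.isChain_range_succ]
    intro m _ h
    have := hl (i + m)
    rw [add_assoc, ← Nat.cast_succ] at this
    exact (this h.symm).symm

lemma cycProd_injective [NeZero ℓ] (hl : CycReduced l)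
    (hw : ¬∃ (v : FreeGroup α) (r : ℕ), 2 ≤ r ∧ cycProd l 0 ℓ = v ^ r) :
    Function.Injective fun i ↦ cycProd l i ℓ := by
  classical
  intro i j hij
  by_contra hne
  have hword := congrArg toWord hij
  simp only [cycProd, toWord_mk, (isReduced_cycWord hl _ _).reduce_eq] at hword
  have hper (k : ZMod ℓ) : l (i + k) = l (j + k) := by
    have := List.map_inj_left.1 hword k.val (List.mem_range.2 k.val_lt)
    simpa using this
  have hper' (k : ZMod ℓ) : l (k + (j - i)) = l k := by
    have := hper (k - i)
    rw [add_sub_cancel] at this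
    rw [this]
    congr 1
    ring
  set d := Nat.gcd (j - i).val ℓ with hd
  have hdℓ : d ∣ ℓ := Nat.gcd_dvd_right _ _
  have hperd (k : ZMod ℓ) : l (k + d) = l k := by
    have hmul (m : ℕ) (k : ZMod ℓ) : l (k + m * (j - i)) = l k := by
      induction m with
      | zero => simp
      | succ m ih => rw [Nat.cast_succ, add_mul, one_mul, ← add_assoc, hper', ih]
    have hbez : (d : ZMod ℓ) = ((Nat.gcdA (j - i).val ℓ : ZMod ℓ).val : ℕ) * (j - i) := by
      have := congrArg (Int.cast : ℤ → ZMod ℓ) (Nat.gcd_eq_gcd_ab (j - i).val ℓ)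
      push_cast at this
      rw [← hd] at this
      rw [this]
      simp [mul_comm]
    rw [hbez]
    exact hmul _ k
  have hpow (m : ℕ) (k : ZMod ℓ) : cycProd l k (d * m) = cycProd l k d ^ m := by
    have hshift (k : ZMod ℓ) (t : ℕ) : cycProd l (k + d) t = cycProd l k t := by
      simp only [cycProd]
      congr 2
      funext s
      rw [← hperd (k + s)]
      congr 1
      ring
    induction m with
    | zero => simp
    | succ m ih =>
      rw [Nat.mul_succ, add_comm, cycProd_add, hshift, ih, pow_succ']
  obtain ⟨r, hr⟩ := hdℓ
  refine hw ⟨cycProd l 0 d, r, ?_, ?_⟩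
  · by_contra! hlt
    have hℓ := NeZero.ne ℓ
    have hr1 : r = 1 := by
      interval_cases r
      · simp at hr; omega
      · rfl
    rw [hr1, mul_one] at hr
    have hdvd : ℓ ∣ (j - i).val := (dvd_of_eq hr).trans (Nat.gcd_dvd_left _ _)
    have h0 : (j - i).val = 0 := Nat.eq_zero_of_dvd_of_lt hdvd (ZMod.val_lt _)
    exact hne (sub_eq_zero.1 ((ZMod.val_eq_zero _).1 h0)).symm
  · rw [← hpow, ← hr]

/-- Every nontrivial element of a free group that is not a proper power is conjugate to one
spelled by a cyclically reduced cyclic word with pairwise distinct rotations. -/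
lemma exists_cyclic_word {w : FreeGroup α} (hw : w ≠ 1)
    (hw' : ¬∃ (v : FreeGroup α) (r : ℕ), 2 ≤ r ∧ w = v ^ r) :
    ∃ (ℓ : ℕ) (_ : NeZero ℓ) (l : ZMod ℓ → α × Bool) (g : FreeGroup α), CycReduced l ∧
      (Function.Injective fun i ↦ cycProd l i ℓ) ∧ w = g * cycProd l 0 ℓ * g⁻¹ := by
  classical
  set L := reduceCyclically w.toWord with hL
  have hcr : IsCyclicallyReduced L := reduceCyclically.isCyclicallyReduced isReduced_toWord
  have hconj : w = mk (reduceCyclically.conjugator w.toWord) * mk L *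
      (mk (reduceCyclically.conjugator w.toWord))⁻¹ := by
    rw [inv_mk, mul_mk, mul_mk, reduceCyclically.conj_conjugator_reduceCyclically, mk_toWord]
  have hL0 : L.length ≠ 0 := by
    intro h
    rw [List.length_eq_zero_iff.1 h, ← one_eq_mk, mul_one, mul_inv_cancel] at hconj
    exact hw hconj
  have : NeZero L.length := ⟨hL0⟩
  let l : ZMod L.length → α × Bool := fun i ↦ L[i.val]'i.val_lt
  have hl : CycReduced l := by
    intro i
    have hval : (i + 1).val = (i.val + 1) % L.length := by
      rw [ZMod.val_add, ZMod.val_one_eq_one_mod, Nat.add_mod_mod]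
    rcases (Nat.succ_le_of_lt i.val_lt).lt_or_eq with hi | hi
    · have h := List.isChain_iff_getElem.1 hcr.isReduced i.val hi
      simp only [l, hval, Nat.mod_eq_of_lt hi]
      exact fun h' ↦ (h h'.symm).symm
    · have h0 : (i + 1).val = 0 := by rw [hval, ← Nat.succ_eq_add_one, hi, Nat.mod_self]
      have h := hcr.2 (L[i.val]'i.val_lt) (by
        rw [List.getLast?_eq_getElem?, List.getElem?_eq_some_iff.2]
        · rfl
        · exact ⟨by omega, by congr 1; omega⟩) (L[0]'(by omega)) (by
        rw [List.head?_eq_getElem?, List.getElem?_eq_getElem]; rfl)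
      simp only [l, h0]
      exact fun h' ↦ (h h'.symm).symm
  have hprod : cycProd l 0 L.length = mk L := by
    rw [cycProd]
    congr 1
    refine List.ext_getElem (by simp) fun k h1 h2 ↦ ?_
    simp [l, ZMod.val_natCast, Nat.mod_eq_of_lt h2]
  refine ⟨L.length, this, l, _, hl, cycProd_injective hl ?_, by rw [hprod]; exact hconj⟩
  rintro ⟨v, r, hr, hv⟩
  rw [hprod] at hv
  refine hw' ⟨mk (reduceCyclically.conjugator w.toWord) * v *
    (mk (reduceCyclically.conjugator w.toWord))⁻¹, r, hr, ?_⟩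
  rw [conj_pow, ← hv]
  exact hconj

end CyclicWords

end FreeGroup

namespace FreeGroup

section PathCocycle

variable {α V A : Type*} [MulAction (FreeGroup α) V] [AddCommGroup A]

/-- `P g v` behaves as the integral of a cochain along the path reading `g` from `v`. -/
def IsPathCocycle (P : FreeGroup α → V → A) : Prop :=
  ∀ g h v, P (g * h) v = P g v + P h (g⁻¹ • v)

lemma exists_isPathCocycle (c : V × α → A) :
    ∃ P : FreeGroup α → V → A, IsPathCocycle P ∧ ∀ a v, P (of a) v = c (v, a) := by
  let T (a : α) : Equiv.Perm (V × A) :=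
    { toFun := fun p ↦ (of a • p.1, p.2 + c (of a • p.1, a))
      invFun := fun p ↦ ((of a)⁻¹ • p.1, p.2 - c (p.1, a))
      left_inv := fun p ↦ by simp
      right_inv := fun p ↦ by simp }
  have hT (a : α) : lift T (of a) = T a := lift_apply_of
  have key (g : FreeGroup α) (v : V) (x : A) :
      lift T g (v, x) = (g • v, x + (lift T g (v, 0)).2) := by
    induction g using FreeGroup.induction_on generalizing v x with
    | C1 => simp
    | of a => simp [T]
    | inv_of a _ =>
      rw [_root_.map_inv, hT]
      change ((of a)⁻¹ • v, x - c (v, a)) = ((of a)⁻¹ • v, x + (0 - c (v, a)))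
      rw [zero_sub, sub_eq_add_neg]
    | mul a b ha hb =>
      rw [_root_.map_mul, Equiv.Perm.mul_apply, Equiv.Perm.mul_apply, hb v x, hb v 0,
        ha _ (x + _), ha _ (0 + _), mul_smul]
      simp [add_assoc]
  refine ⟨fun g v ↦ (lift T g (g⁻¹ • v, 0)).2, fun g h v ↦ ?_, fun a v ↦ ?_⟩
  · simp only [_root_.map_mul, Equiv.Perm.mul_apply]
    rw [key h, key g]
    simp [mul_smul, add_comm]
  · simp [T]

variable {P : FreeGroup α → V → A}

lemma IsPathCocycle.map_one (hP : IsPathCocycle P) (v : V) : P 1 v = 0 := by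
  simpa using hP 1 1 v

lemma IsPathCocycle.map_inv (hP : IsPathCocycle P) (g : FreeGroup α) (v : V) :
    P g⁻¹ v = -P g (g • v) := by
  have := hP g⁻¹ g v
  rw [inv_mul_cancel, hP.map_one, inv_inv] at this
  exact (neg_eq_of_add_eq_zero_left this.symm).symm

lemma IsPathCocycle.map_conj (hP : IsPathCocycle P) (g h : FreeGroup α) {v : V}
    (hv : h • g⁻¹ • v = g⁻¹ • v) : P (g * h * g⁻¹) v = P h (g⁻¹ • v) := by
  have : (g * h)⁻¹ • v = g⁻¹ • v := by
    rw [mul_inv_rev, mul_smul, inv_smul_eq_iff, hv]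
  rw [hP, hP, hP.map_inv, this, smul_inv_smul]
  abel

/-- Over a transitive action, a path cocycle vanishing on the stabiliser is a coboundary. -/
lemma IsPathCocycle.exists_potential (hP : IsPathCocycle P) (o : V)
    (ho : ∀ s : FreeGroup α, s • o = o → P s o = 0) (htrans : ∀ v, ∃ g : FreeGroup α, v = g • o) :
    ∃ f : V → A, ∀ v a, P (of a) v = f ((of a)⁻¹ • v) - f v := by
  choose s hs using htrans
  have key (g : FreeGroup α) : P (s (g • o))⁻¹ o = P g⁻¹ o := by
    have h1 : g⁻¹ = (g⁻¹ * s (g • o)) * (s (g • o))⁻¹ := by group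
    have h2 : (g⁻¹ * s (g • o)) • o = o := by rw [mul_smul, ← hs, inv_smul_smul]
    rw [h1, hP, ho _ h2, zero_add, inv_smul_eq_iff.2 h2.symm]
  refine ⟨fun v ↦ P (s v)⁻¹ o, fun v a ↦ ?_⟩
  have h1 := key ((of a)⁻¹ * s v)
  rw [mul_smul, ← hs v] at h1
  beta_reduce
  rw [h1, mul_inv_rev, inv_inv, hP, inv_inv, ← hs v]
  abel

variable {ℓ : ℕ} {l : ZMod ℓ → α × Bool}

lemma IsPathCocycle.map_cycProd [NeZero ℓ] {c : V × α → A} (hP : IsPathCocycle P)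
    (hc : ∀ a v, P (of a) v = c (v, a)) {y : ZMod ℓ → V} (hy : IsLoop l y) :
    P (cycProd l 0 ℓ) (y 0) = loopSum l c y := by
  have hstep (i : ZMod ℓ) : P (mk [l i]) (y i) =
      if (l i).2 then c (loopEdge l y i) else -c (loopEdge l y i) := by
    have := isLoop_iff.1 hy i
    rw [mk_singleton_eq] at this ⊢
    unfold loopEdge baseIdx
    split_ifs at this ⊢
    · rw [hc]
    · rw [hP.map_inv, hc, this, inv_inv]
  have key (k : ℕ) : P (cycProd l 0 k) (y 0) = ∑ j ∈ Finset.range k,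
      if (l j).2 then c (loopEdge l y j) else -c (loopEdge l y j) := by
    induction k with
    | zero => simp [hP.map_one]
    | succ k ih =>
      rw [Finset.sum_range_succ, cycProd_succ, hP, ih, ← hy.apply_add, zero_add, hstep]
  rw [key, loopSum]
  refine Finset.sum_bij' (fun j _ ↦ (j : ZMod ℓ)) (fun i _ ↦ i.val) ?_ ?_ ?_ ?_ ?_
  · simp
  · intro i _
    exact Finset.mem_range.2 i.val_lt
  · intro j hj
    rw [ZMod.val_natCast, Nat.mod_eq_of_lt (Finset.mem_range.1 hj)]
  · simp
  · simp

/-- Equivariance along the edges of a path gives equivariance along the path. -/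
lemma exists_pathEdges {Γ : Type*} [Group Γ] (π : FreeGroup α →* Γ) (g : FreeGroup α) (v : V) :
    ∃ E : Finset (V × α), ∀ φ : V → Γ,
      (∀ e ∈ E, φ ((of e.2)⁻¹ • e.1) = (π (of e.2))⁻¹ * φ e.1) → φ (g⁻¹ • v) = (π g)⁻¹ * φ v := by
  classical
  induction g using FreeGroup.induction_on generalizing v with
  | C1 => exact ⟨∅, by simp⟩
  | of a => exact ⟨{(v, a)}, by simp⟩
  | inv_of a _ =>
    refine ⟨{(of a • v, a)}, fun φ h ↦ ?_⟩
    have := h _ (Finset.mem_singleton_self _)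
    simp only [inv_smul_smul] at this
    simp [this]
  | mul g h hg hh =>
    obtain ⟨E₁, h₁⟩ := hg v
    obtain ⟨E₂, h₂⟩ := hh (g⁻¹ • v)
    refine ⟨E₁ ∪ E₂, fun φ h ↦ ?_⟩
    rw [mul_inv_rev, mul_smul, h₂ φ fun e he ↦ h e (by simp [he]),
      h₁ φ fun e he ↦ h e (by simp [he])]
    simp [mul_assoc]

end PathCocycle

/-- An element of a closure lies in the closure of a finite subset. -/
lemma _root_.Subgroup.exists_finite_subset_mem_closure {G : Type*} [Group G] {X : Set G} {x : G}
    (hx : x ∈ Subgroup.closure X) : ∃ Y ⊆ X, Y.Finite ∧ x ∈ Subgroup.closure Y := by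
  induction hx using Subgroup.closure_induction with
  | mem x hx => exact ⟨{x}, by simpa using hx, Set.finite_singleton _, Subgroup.subset_closure rfl⟩
  | one => exact ⟨∅, by simp, Set.finite_empty, one_mem _⟩
  | mul x y _ _ hx hy =>
    obtain ⟨Y, hY, hf, h⟩ := hx
    obtain ⟨Y', hY', hf', h'⟩ := hy
    exact ⟨Y ∪ Y', Set.union_subset hY hY', hf.union hf', mul_mem
      (Subgroup.closure_mono Set.subset_union_left h)
      (Subgroup.closure_mono Set.subset_union_right h')⟩
  | inv x _ hx =>
    obtain ⟨Y, hY, hf, h⟩ := hx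
    exact ⟨Y, hY, hf, inv_mem h⟩

open Pointwise commutatorElement in
/-- Finitely many elements of a torsion-free one-relator group generating a group with torsion
abelianisation are trivial. -/
lemma eq_one_of_pow_mem_commutator {α : Type*} {ℓ : ℕ} {l : ZMod ℓ → α × Bool} [NeZero ℓ]
    (hl : CycReduced l) (hinj : Function.Injective fun i ↦ cycProd l i ℓ)
    {Γ : Type*} [Group Γ] (π : FreeGroup α →* Γ)
    (hπ : π.ker = Subgroup.normalClosure {cycProd l 0 ℓ}) {t : Set (FreeGroup α)} (ht : t.Finite)
    (h : ∀ g ∈ t, ∃ N ≠ 0, π g ^ N ∈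
      ⁅Subgroup.closure (π '' t), Subgroup.closure (π '' t)⁆) : ∀ g ∈ t, π g = 1 := by
  classical
  have hlift : ∀ g ∈ t, ∃ (N : ℕ) (c : FreeGroup α) (Y : Set (FreeGroup α)), N ≠ 0 ∧
      c ∈ ⁅Subgroup.closure t, Subgroup.closure t⁆ ∧
      Y ⊆ Group.conjugatesOfSet {cycProd l 0 ℓ} ∧ Y.Finite ∧ c⁻¹ * g ^ N ∈ Subgroup.closure Y := by
    intro g hg
    obtain ⟨N, hN, hmem⟩ := h g hg
    rw [← MonoidHom.map_closure, ← Subgroup.map_commutator] at hmem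
    obtain ⟨c, hc, hcN⟩ := hmem
    have : c⁻¹ * g ^ N ∈ π.ker := by simp [MonoidHom.mem_ker, hcN]
    rw [hπ] at this
    obtain ⟨Y, hY, hYf, hmem⟩ := Subgroup.exists_finite_subset_mem_closure this
    exact ⟨N, c, Y, hN, hc, hY, hYf, hmem⟩
  choose! N c Y hN hc hYsub hYfin hmem using hlift
  let X := ⋃ g ∈ t, Y g
  have hX : X.Finite := ht.biUnion hYfin
  let S := Subgroup.closure (t ∪ X)
  let o : FreeGroup α ⧸ S := QuotientGroup.mk 1
  have hstab (s : FreeGroup α) : s • o = o ↔ s ∈ S := by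
    change (QuotientGroup.mk (s * 1) : FreeGroup α ⧸ S) = QuotientGroup.mk 1 ↔ _
    rw [mul_one, eq_comm, QuotientGroup.eq]
    simp
  have hloop : ∀ x ∈ X, ∃ (u : FreeGroup α) (y : ZMod ℓ → FreeGroup α ⧸ S),
      x = u * cycProd l 0 ℓ * u⁻¹ ∧ IsLoop l y ∧ y 0 = u⁻¹ • o := by
    intro x hx
    have hxc : x ∈ Group.conjugatesOfSet {cycProd l 0 ℓ} := by
      obtain ⟨g, hg, hxg⟩ := Set.mem_iUnion₂.1 hx
      exact hYsub g hg hxg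
    obtain ⟨w', hw', hconj⟩ := Group.mem_conjugatesOfSet_iff.1 hxc
    rw [Set.mem_singleton_iff.1 hw'] at hconj
    obtain ⟨u, hu⟩ := isConj_iff.1 hconj
    have hxo : x • o = o := (hstab x).2 (Subgroup.subset_closure (.inr hx))
    have : cycProd l 0 ℓ • u⁻¹ • o = u⁻¹ • o := by
      rw [eq_inv_smul_iff, smul_smul, smul_smul, hu, hxo]
    obtain ⟨y, hy, hy0⟩ := exists_isLoop this
    exact ⟨u, y, hu.symm, hy, hy0⟩
  choose! u y hxu hy hy0 using hloop
  choose Ep hEp using fun g : FreeGroup α ↦ exists_pathEdges π g o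
  let E : Finset ((FreeGroup α ⧸ S) × α) :=
    ht.toFinset.biUnion Ep ∪ hX.toFinset.biUnion fun x ↦ Finset.univ.image (loopEdge l (y x))
  obtain ⟨φ, hφ⟩ := exists_equivariant hl hinj cycProd_tipIdx π
    (relation_of_forall_ne π (MonoidHom.mem_ker.1 (hπ ▸ Subgroup.subset_normalClosure rfl))) E
    fun d hd ↦ by
      obtain ⟨P, hP, hPd⟩ := exists_isPathCocycle d
      let χ : S →* Multiplicative ℚ :=
        { toFun := fun s ↦ Multiplicative.ofAdd (P s o)
          map_one' := by simp [hP.map_one]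
          map_mul' := fun s s' ↦ by
            rw [Subgroup.coe_mul, hP, inv_smul_eq_iff.2 ((hstab s).2 s.2).symm, ofAdd_add] }
      have hχ {s : FreeGroup α} (hs : s ∈ χ.ker.map S.subtype) : P s o = 0 := by
        obtain ⟨s', hs', rfl⟩ := hs
        exact ofAdd_eq_one.1 hs'
      have hXχ : Subgroup.closure X ≤ χ.ker.map S.subtype := by
        rw [Subgroup.closure_le]
        intro x hx
        refine ⟨⟨x, Subgroup.subset_closure (.inr hx)⟩, ?_, rfl⟩
        refine ofAdd_eq_one.2 ?_
        have hxo : x • o = o := (hstab x).2 (Subgroup.subset_closure (.inr hx))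
        have hfix : cycProd l 0 ℓ • (u x)⁻¹ • o = (u x)⁻¹ • o := by
          rw [eq_inv_smul_iff, smul_smul, smul_smul, ← hxu x hx, hxo]
        change P x o = 0
        rw [hxu x hx, hP.map_conj _ _ hfix, ← hy0 x hx, hP.map_cycProd hPd (hy x hx)]
        refine hd _ (hy x hx) fun i ↦ Finset.mem_union_right _ ?_
        exact Finset.mem_biUnion.2 ⟨x, hX.mem_toFinset.2 hx, Finset.mem_image_of_mem _ (by simp)⟩
      have hcomm : ⁅S, S⁆ ≤ χ.ker.map S.subtype := by
        rw [Subgroup.commutator_le]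
        intro a ha b hb
        refine ⟨⁅(⟨a, ha⟩ : S), (⟨b, hb⟩ : S)⁆, ?_, rfl⟩
        change χ _ = 1
        rw [map_commutatorElement, commutatorElement_eq_one_iff_commute]
        exact Commute.all _ _
      have hS : S ≤ χ.ker.map S.subtype := by
        rw [Subgroup.closure_le]
        rintro g (hg | hg)
        · have h1 : c g ∈ χ.ker.map S.subtype :=
            hcomm (Subgroup.commutator_mono (Subgroup.closure_mono Set.subset_union_left)
              (Subgroup.closure_mono Set.subset_union_left) (hc g hg))
          have h2 : (c g)⁻¹ * g ^ N g ∈ χ.ker.map S.subtype :=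
            hXχ (Subgroup.closure_mono (Set.subset_biUnion_of_mem hg) (hmem g hg))
          have h3 := hχ ((Subgroup.mul_mem_cancel_left _ (inv_mem h1)).1 h2)
          have hgS : g ∈ S := Subgroup.subset_closure (.inl hg)
          have h4 : χ ⟨g, hgS⟩ ^ N g = 1 := by
            rw [← map_pow]
            exact ofAdd_eq_one.2 h3
          refine ⟨⟨g, hgS⟩, ?_, rfl⟩
          have h5 : (N g : ℚ) * P g o = 0 := by
            have := congrArg Multiplicative.toAdd h4
            simpa [χ] using this
          refine ofAdd_eq_one.2 ?_
          simpa [hN g hg] using h5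
        · exact hXχ (Subgroup.subset_closure hg)
      obtain ⟨f, hf⟩ := hP.exists_potential o (fun s hs ↦ hχ (hS ((hstab s).1 hs))) fun v ↦ by
        obtain ⟨g, rfl⟩ := QuotientGroup.mk_surjective v
        exact ⟨g, by change _ = QuotientGroup.mk (g * 1); rw [mul_one]⟩
      exact ⟨f, fun e _ ↦ by rw [← hf, hPd]⟩
  intro g hg
  have h1 := hEp g φ fun e he ↦ hφ e (Finset.mem_union_left _
    (Finset.mem_biUnion.2 ⟨g, ht.mem_toFinset.2 hg, he⟩))
  have hgo : g • o = o := (hstab g).2 (Subgroup.subset_closure (.inl hg))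
  rw [inv_smul_eq_iff.2 hgo.symm] at h1
  simpa using h1

end FreeGroup

open TensorProduct in
/-- An element killed by every homomorphism to `ℚ` is torsion in the abelianisation. -/
lemma exists_pow_mem_commutator {B : Type*} [Group B] (b : B)
    (h : ∀ χ : B →* Multiplicative ℚ, χ b = 1) : ∃ N : ℕ, N ≠ 0 ∧ b ^ N ∈ commutator B := by
  let M := Additive (Abelianization B)
  let m : M := Additive.ofMul (Abelianization.of b)
  have hm : TensorProduct.mk ℤ ℚ M 1 m = 0 := by
    rw [← Module.forall_dual_apply_eq_zero_iff ℚ]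
    intro f
    let χ : M →+ ℚ := (f.restrictScalars ℤ).toAddMonoidHom.comp (TensorProduct.mk ℤ ℚ M 1).toAddMonoidHom
    exact ofAdd_eq_one.1 (h ((AddMonoidHom.toMultiplicativeLeft χ).comp Abelianization.of))
  rw [IsLocalizedModule.eq_zero_iff (nonZeroDivisors ℤ)] at hm
  obtain ⟨c, hc⟩ := hm
  have hc0 : (c : ℤ) ≠ 0 := nonZeroDivisors.ne_zero c.2
  refine ⟨(c : ℤ).natAbs, Int.natAbs_ne_zero.2 hc0, ?_⟩
  have h1 : Abelianization.of b ^ (c : ℤ) = 1 := hc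
  rw [← Abelianization.ker_of, MonoidHom.mem_ker, map_pow, ← zpow_natCast]
  rcases Int.natAbs_eq (c : ℤ) with h2 | h2
  · rw [← h2, h1]
  · rw [← neg_neg ((c : ℤ).natAbs : ℤ), ← h2, zpow_neg, h1, inv_one]

/-- Every nontrivial finitely generated subgroup maps nontrivially to `ℚ`. -/
def LocallyIndicable (G : Type*) [Group G] : Prop :=
  ∀ t : Set G, t.Finite → (∃ g ∈ t, g ≠ 1) → ∃ χ : Subgroup.closure t →* Multiplicative ℚ,
    ∃ (g : G) (hg : g ∈ t), χ ⟨g, Subgroup.subset_closure hg⟩ ≠ 1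

lemma FreeGroup.locallyIndicable {α : Type*} {ℓ : ℕ} {l : ZMod ℓ → α × Bool} [NeZero ℓ]
    (hl : CycReduced l) (hinj : Function.Injective fun i ↦ cycProd l i ℓ)
    {G : Type*} [Group G] (π : FreeGroup α →* G) (hsurj : Function.Surjective π)
    (hπ : π.ker = Subgroup.normalClosure {cycProd l 0 ℓ}) : LocallyIndicable G := by
  intro t ht ⟨g, hg, hg1⟩
  by_contra! hχ
  choose s hs using hsurj
  have himage : π '' (s '' t) = t := by simp [Set.image_image, hs]
  refine hg1 ?_
  rw [← hs g]
  refine eq_one_of_pow_mem_commutator hl hinj π hπ (ht.image s) ?_ _ (Set.mem_image_of_mem _ hg)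
  rintro _ ⟨x, hx, rfl⟩
  obtain ⟨N, hN, hmem⟩ := exists_pow_mem_commutator
    (⟨x, Subgroup.subset_closure hx⟩ : Subgroup.closure t) fun χ ↦ hχ χ x hx
  refine ⟨N, hN, ?_⟩
  rw [himage, hs, ← Subgroup.map_subtype_commutator]
  exact ⟨_, hmem, rfl⟩

open Pointwise in
lemma LocallyIndicable.uniqueProds {G : Type*} [Group G] (hG : LocallyIndicable G) :
    UniqueProds G := by
  classical
  refine ⟨fun {A B} hA hB ↦ ?_⟩
  induction hn : A.card + B.card using Nat.strong_induction_on generalizing A B with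
  | _ n ih =>
  obtain ⟨a₁, ha₁⟩ := hA
  obtain ⟨b₁, hb₁⟩ := hB
  let t : Set G := A.image (a₁⁻¹ * ·) ∪ B.image (· * b₁⁻¹)
  by_cases ht : ∃ g ∈ t, g ≠ 1
  · obtain ⟨χ, g, hg, hχ⟩ := hG t (by simp only [t, ← Finset.coe_union]; exact Finset.finite_toSet _) ht
    let f (x : G) : ℚ := if h : x ∈ Subgroup.closure t then (χ ⟨x, h⟩).toAdd else 0
    have hf {x y : G} (hx : x ∈ Subgroup.closure t) (hy : y ∈ Subgroup.closure t) :
        f (x * y) = f x + f y := by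
      simp only [f, dif_pos hx, dif_pos hy, dif_pos (mul_mem hx hy)]
      rw [← toAdd_mul, ← map_mul]
      rfl
    have hf1 : f 1 = 0 := by
      have := hf (one_mem _) (one_mem _)
      rw [mul_one] at this
      linarith
    have hfg : f g ≠ 0 := by
      have hgt : g ∈ Subgroup.closure t := Subgroup.subset_closure hg
      simp only [f, dif_pos hgt]
      exact fun h ↦ hχ h
    have hAt {a : G} (ha : a ∈ A) : a₁⁻¹ * a ∈ Subgroup.closure t :=
      Subgroup.subset_closure (.inl (Finset.mem_image_of_mem _ ha))
    have hBt {b : G} (hb : b ∈ B) : b * b₁⁻¹ ∈ Subgroup.closure t :=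
      Subgroup.subset_closure (.inr (Finset.mem_image_of_mem (· * b₁⁻¹) hb))
    obtain ⟨a₂, ha₂, hamax⟩ := A.exists_max_image (fun a ↦ f (a₁⁻¹ * a)) ⟨a₁, ha₁⟩
    obtain ⟨b₂, hb₂, hbmax⟩ := B.exists_max_image (fun b ↦ f (b * b₁⁻¹)) ⟨b₁, hb₁⟩
    let A' := A.filter fun a ↦ f (a₁⁻¹ * a) = f (a₁⁻¹ * a₂)
    let B' := B.filter fun b ↦ f (b * b₁⁻¹) = f (b₂ * b₁⁻¹)
    have hlt : A'.card + B'.card < n := by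
      have hA' : A'.card ≤ A.card := Finset.card_filter_le _ _
      have hB' : B'.card ≤ B.card := Finset.card_filter_le _ _
      by_contra! hle
      have hAA : A' = A := Finset.eq_of_subset_of_card_le (Finset.filter_subset _ _) (by omega)
      have hBB : B' = B := Finset.eq_of_subset_of_card_le (Finset.filter_subset _ _) (by omega)
      have hAc {a : G} (ha : a ∈ A) : f (a₁⁻¹ * a) = f (a₁⁻¹ * a₂) := by
        rw [← hAA] at ha
        exact (Finset.mem_filter.1 ha).2
      have hBc {b : G} (hb : b ∈ B) : f (b * b₁⁻¹) = f (b₂ * b₁⁻¹) := by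
        rw [← hBB] at hb
        exact (Finset.mem_filter.1 hb).2
      rcases hg with hg | hg
      · obtain ⟨a, ha, rfl⟩ := Finset.mem_image.1 (Finset.mem_coe.1 hg)
        exact hfg (by rw [hAc ha, ← hAc ha₁, inv_mul_cancel, hf1])
      · obtain ⟨b, hb, rfl⟩ := Finset.mem_image.1 (Finset.mem_coe.1 hg)
        exact hfg (by rw [hBc hb, ← hBc hb₁, mul_inv_cancel, hf1])
    obtain ⟨a₀, ha₀, b₀, hb₀, huniq⟩ := ih _ hlt (A := A') (B := B')
      ⟨a₂, by simp [A', ha₂]⟩ ⟨b₂, by simp [B', hb₂]⟩ rfl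
    rw [Finset.mem_filter] at ha₀ hb₀
    refine ⟨a₀, ha₀.1, b₀, hb₀.1, fun a b ha hb hab ↦ ?_⟩
    have hprod : f (a₁⁻¹ * a) + f (b * b₁⁻¹) = f (a₁⁻¹ * a₀) + f (b₀ * b₁⁻¹) := by
      rw [← hf (hAt ha) (hBt hb), ← hf (hAt ha₀.1) (hBt hb₀.1)]
      congr 1
      calc a₁⁻¹ * a * (b * b₁⁻¹) = a₁⁻¹ * (a * b) * b₁⁻¹ := by group
        _ = _ := by rw [hab]; group
    have h1 := hamax a ha
    have h2 := hbmax b hb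
    refine huniq (Finset.mem_filter.2 ⟨ha, ?_⟩) (Finset.mem_filter.2 ⟨hb, ?_⟩) hab <;> linarith
  · push Not at ht
    refine ⟨a₁, ha₁, b₁, hb₁, fun a b ha hb _ ↦ ⟨?_, ?_⟩⟩
    · exact (inv_mul_eq_one.1 (ht _ (.inl (Finset.mem_image_of_mem _ ha)))).symm
    · exact mul_inv_eq_one.1 (ht _ (.inr (Finset.mem_image_of_mem (· * b₁⁻¹) hb)))

namespace FreeGroup

variable {α : Type*} {G : Type*} [Group G] (π : FreeGroup α →* G)

/-- A nontrivial normal subgroup generated by the conjugates of `w` has a path cocycle on the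
quotient which does not vanish on `w`. -/
lemma exists_isPathCocycle_ne_zero (k : Type*) [Field k] (hsurj : Function.Surjective π)
    {w : FreeGroup α} (hw : w ≠ 1) (hπ : π.ker = Subgroup.normalClosure {w}) :
    letI := MulAction.compHom G π
    ∃ P : FreeGroup α → G → k, IsPathCocycle P ∧ ∃ v, P w v ≠ 0 := by
  let := MulAction.compHom G π
  have hsmul (g : FreeGroup α) (v : G) : g • v = π g * v := rfl
  choose s hs using hsurj
  have hwker : w ∈ π.ker := hπ ▸ Subgroup.subset_normalClosure rfl
  let b := IsFreeGroup.basis π.ker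
  have : Nonempty (IsFreeGroup.Generators π.ker) := by
    by_contra! hempty
    have := b.repr.toEquiv.subsingleton
    exact hw (congrArg Subtype.val (Subsingleton.elim (⟨w, hwker⟩ : π.ker) 1))
  obtain ⟨i⟩ := this
  let θ : π.ker →* Multiplicative k := b.lift fun _ ↦ Multiplicative.ofAdd 1
  have hθ : θ (b i) ≠ 1 := by
    have : θ (b i) = Multiplicative.ofAdd 1 := congrFun (b.lift.symm_apply_apply _) i
    rw [this]
    exact fun h ↦ one_ne_zero (ofAdd_eq_one.1 h)
  have hmem (g : FreeGroup α) (v : G) : (s v)⁻¹ * g * s (g⁻¹ • v) ∈ π.ker := by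
    simp [MonoidHom.mem_ker, hs, hsmul]
  let P (g : FreeGroup α) (v : G) : k := (θ ⟨_, hmem g v⟩).toAdd
  have hP : IsPathCocycle P := fun g h v ↦ by
    simp only [P]
    rw [← toAdd_mul, ← _root_.map_mul]
    congr 2
    ext1
    simp [mul_smul, mul_assoc]
  refine ⟨P, hP, ?_⟩
  by_contra! h0
  have hfix {g : FreeGroup α} (hg : g ∈ π.ker) (v : G) : g • v = v := by
    rw [hsmul, MonoidHom.mem_ker.1 hg, one_mul]
  have key : ∀ g ∈ π.ker, P g 1 = 0 := by
    intro g hg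
    rw [hπ] at hg
    refine Subgroup.closure_induction (p := fun g _ ↦ P g 1 = 0) ?_ (hP.map_one _) ?_ ?_ hg
    · intro x hx
      obtain ⟨w', hw', hconj⟩ := Group.mem_conjugatesOfSet_iff.1 hx
      obtain ⟨u, rfl⟩ := isConj_iff.1 hconj
      obtain rfl := Set.mem_singleton_iff.1 hw'
      rw [hP.map_conj _ _ (hfix hwker _), h0]
    · intro x y hx _ h1 h2
      rw [hP, inv_smul_eq_iff.2 (hfix (hπ ▸ hx) _).symm, h1, h2, add_zero]
    · intro x hx h1
      rw [hP.map_inv, hfix (hπ ▸ hx), h1, neg_zero]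
  have h1 : s 1 * b i * (s 1)⁻¹ ∈ π.ker := by
    simp [MonoidHom.mem_ker, hs, MonoidHom.mem_ker.1 (b i).2]
  have h2 := key _ h1
  refine hθ ?_
  rw [← toAdd_eq_zero, ← h2]
  congr 2
  ext1
  have h3 : (s 1 * b i * (s 1)⁻¹)⁻¹ • (1 : G) = 1 := inv_smul_eq_iff.2 (hfix h1 1).symm
  simp only [h3]
  group

variable {ℓ : ℕ} {l : ZMod ℓ → α × Bool} [NeZero ℓ]

/-- Over the group algebra of a group with unique products, the loops reading a nontrivial
relator are independent: a cochain can take arbitrary prescribed values on them. -/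
lemma exists_isPathCocycle_eq {k : Type*} [Field k] [UniqueProds G] [Fintype α]
    (hsurj : Function.Surjective π) (hw : cycProd l 0 ℓ ≠ 1)
    (hπ : π.ker = Subgroup.normalClosure {cycProd l 0 ℓ}) (u : G → k) :
    letI := MulAction.compHom G π
    ∃ P : FreeGroup α → G → k, IsPathCocycle P ∧ ∀ v, P (cycProd l 0 ℓ) v = u v := by
  classical
  let := MulAction.compHom G π
  have hsmul (g : FreeGroup α) (v : G) : g • v = π g * v := rfl
  have hwker : π (cycProd l 0 ℓ) = 1 := by
    rw [← MonoidHom.mem_ker, hπ]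
    exact Subgroup.subset_normalClosure rfl
  obtain ⟨y, hy, hy0⟩ := exists_isLoop (l := l) (v := (1 : G)) (by rw [hsmul, hwker, one_mul])
  have hyv (v : G) : IsLoop l fun i ↦ y i * v := fun i ↦ by
    simp only [hy i, hsmul, mul_assoc]
  let d (x : α) : MonoidAlgebra k G := ∑ i with (l i).1 = x,
    MonoidAlgebra.single (y (baseIdx l i)) (if (l i).2 then 1 else -1)
  let L (φ : G → k) : MonoidAlgebra k G →ₗ[k] k := Finsupp.linearCombination k φ ∘ₗ
    (MonoidAlgebra.coeffLinearEquiv k).toLinearMap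
  have hL (φ : G → k) (g : G) (a : k) : L φ (MonoidAlgebra.single g a) = a * φ g :=
    Finsupp.linearCombination_single _ _ _
  have hLd (φ : G → k) (x : α) (v : G) : L φ (d x * MonoidAlgebra.single v 1) =
      ∑ i with (l i).1 = x, if (l i).2 then φ (y (baseIdx l i) * v)
        else -φ (y (baseIdx l i) * v) := by
    simp only [d, Finset.sum_mul, map_sum, MonoidAlgebra.single_mul_single, mul_one]
    refine Finset.sum_congr rfl fun i _ ↦ ?_
    rw [hL]
    split_ifs <;> simp
  have hloop (c : G × α → k) (v : G) : loopSum l c (fun i ↦ y i * v) =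
      ∑ x, L (fun g ↦ c (g, x)) (d x * MonoidAlgebra.single v 1) := by
    simp only [hLd]
    rw [loopSum, ← Finset.sum_fiberwise Finset.univ fun i ↦ (l i).1]
    refine Finset.sum_congr rfl fun x _ ↦ Finset.sum_congr rfl fun i hi ↦ ?_
    rw [← (Finset.mem_filter.1 hi).2]
    rfl
  have hval {P : FreeGroup α → G → k} (hP : IsPathCocycle P) {c : G × α → k}
      (hc : ∀ a v, P (of a) v = c (v, a)) (v : G) : P (cycProd l 0 ℓ) v =
        ∑ x, L (fun g ↦ c (g, x)) (d x * MonoidAlgebra.single v 1) := by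
    rw [← hloop, ← hP.map_cycProd hc (hyv v), hy0, one_mul]
  obtain ⟨x, hx⟩ : ∃ x, d x ≠ 0 := by
    by_contra! h0
    obtain ⟨P, hP, v, hv⟩ := exists_isPathCocycle_ne_zero π k hsurj hw hπ
    refine hv ?_
    rw [hval hP (c := fun e ↦ P (of e.2) e.1) fun _ _ ↦ rfl]
    simp [h0]
  obtain ⟨φ, hφ⟩ := LinearMap.dualMap_surjective_of_injective
    (f := LinearMap.mulLeft k (d x)) (mul_right_injective₀ hx) (L u)
  let c (e : G × α) : k := if e.2 = x then φ (MonoidAlgebra.single e.1 1) else 0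
  obtain ⟨P, hP, hPc⟩ := exists_isPathCocycle c
  refine ⟨P, hP, fun v ↦ ?_⟩
  rw [hval hP (c := c) hPc, Finset.sum_eq_single x]
  · have h1 (z : MonoidAlgebra k G) : L (fun g ↦ φ (MonoidAlgebra.single g 1)) z = φ z := by
      induction z using MonoidAlgebra.induction_linear with
      | zero => simp
      | add z z' hz hz' => rw [map_add, map_add, hz, hz']
      | single g a =>
        rw [hL, ← smul_eq_mul, ← map_smul, MonoidAlgebra.smul_single, smul_eq_mul, mul_one]
    simp only [c, if_true]
    rw [h1]
    have h2 := LinearMap.congr_fun hφ (MonoidAlgebra.single v 1)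
    rw [hL, one_mul] at h2
    exact h2
  · intro x' _ hx'
    simp only [c, hx', if_false]
    simp [hLd]
  · simp

/-- The relation module of a torsion-free one-relator group is free on the class of the relator:
homomorphisms from the relation subgroup to a field take arbitrary prescribed values on the
conjugates of the relator. -/
theorem exists_hom_conj_eq {k : Type*} [Field k] [Fintype α] (hsurj : Function.Surjective π)
    {w : FreeGroup α} (hw : w ≠ 1) (hw' : ¬∃ (v : FreeGroup α) (r : ℕ), 2 ≤ r ∧ w = v ^ r)
    (hπ : π.ker = Subgroup.normalClosure {w}) (u : G → k) :
    ∃ Θ : π.ker →* Multiplicative k, ∀ (g : FreeGroup α) (r : π.ker), (r : FreeGroup α) =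
      g * w * g⁻¹ → Θ r = Multiplicative.ofAdd (u (π g)) := by
  obtain ⟨ℓ, _, l, g₀, hl, hinj, rfl⟩ := exists_cyclic_word hw hw'
  have hπ₀ : π.ker = Subgroup.normalClosure {cycProd l 0 ℓ} := by
    rw [hπ]
    refine le_antisymm (Subgroup.normalClosure_le_normal ?_) (Subgroup.normalClosure_le_normal ?_)
    · rw [Set.singleton_subset_iff]
      exact Subgroup.normalClosure_normal.conj_mem _ (Subgroup.subset_normalClosure
        (Set.mem_singleton _)) _
    · rw [Set.singleton_subset_iff]
      have := Subgroup.normalClosure_normal.conj_mem _ (Subgroup.subset_normalClosure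
        (Set.mem_singleton (g₀ * cycProd l 0 ℓ * g₀⁻¹))) g₀⁻¹
      simpa [mul_assoc] using this
  have := (locallyIndicable hl hinj π hsurj hπ₀).uniqueProds
  let := MulAction.compHom G π
  have hw₀ : cycProd l 0 ℓ ≠ 1 := fun h ↦ hw (by simp [h])
  obtain ⟨P, hP, hPu⟩ := exists_isPathCocycle_eq π hsurj hw₀ hπ₀ fun v ↦ u (v⁻¹ * (π g₀)⁻¹)
  have hfix {g : FreeGroup α} (hg : g ∈ π.ker) (v : G) : g • v = v := by
    change π g * v = v
    rw [MonoidHom.mem_ker.1 hg, one_mul]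
  refine ⟨{ toFun := fun r ↦ Multiplicative.ofAdd (P r 1)
            map_one' := by simp [hP.map_one]
            map_mul' := fun r r' ↦ by
              rw [Subgroup.coe_mul, hP, inv_smul_eq_iff.2 (hfix r.2 _).symm, ofAdd_add] }, ?_⟩
  intro g r hr
  have hwker : cycProd l 0 ℓ ∈ π.ker := by
    rw [hπ₀]
    exact Subgroup.subset_normalClosure (Set.mem_singleton _)
  have h1 : (r : FreeGroup α) = (g * g₀) * cycProd l 0 ℓ * (g * g₀)⁻¹ := by
    rw [hr]
    group
  change Multiplicative.ofAdd (P r 1) = _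
  rw [h1, hP.map_conj _ _ (hfix hwker _), hPu]
  congr 2
  change ((π (g * g₀)⁻¹) * 1)⁻¹ * _ = _
  simp

end FreeGroup

/-- Every homomorphism from a free group lifts along a surjection. -/
lemma IsFreeGroup.exists_lift {X Y Z : Type*} [Group X] [Group Y] [Group Z] [IsFreeGroup X]
    (q : Y →* Z) (hq : Function.Surjective q) (f : X →* Z) : ∃ g : X →* Y, ∀ x, q (g x) = f x := by
  choose s hs using hq
  let b := IsFreeGroup.basis X
  let g : X →* Y := b.lift fun i ↦ s (f (b i))
  have hg (i) : g (b i) = s (f (b i)) := congrFun (b.lift.symm_apply_apply _) i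
  refine ⟨g, fun x ↦ DFunLike.congr_fun (f := q.comp g) (g := f) (b.ext_hom _ _ fun i ↦ ?_) x⟩
  simp [hg, hs]

/-- Two-cocycles on free groups with trivial coefficients are coboundaries. -/
lemma IsFreeGroup.exists_cobounding {X k : Type*} [Group X] [IsFreeGroup X] [AddCommGroup k]
    (f : X → X → k) (hf : ∀ x y z, f y z + f x (y * z) = f (x * y) z + f x y) :
    ∃ γ : X → k, ∀ x y, f x y = γ x + γ y - γ (x * y) := by
  have hf1 (x : X) : f 1 x = f 1 1 := by simpa using hf 1 1 x
  let E : Subgroup (X × Equiv.Perm (X × k)) :=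
    { carrier := {p | ∃ c, ∀ x a, p.2 (x, a) = (p.1 * x, a + f p.1 x + c)}
      mul_mem' := by
        rintro ⟨g, σ⟩ ⟨h, τ⟩ ⟨c, hc⟩ ⟨c', hc'⟩
        refine ⟨f g h + c + c', fun x a ↦ ?_⟩
        simp only at hc hc'
        simp only [Prod.mk_mul_mk, Equiv.Perm.mul_apply, hc, hc', mul_assoc, Prod.mk.injEq, true_and]
        have := hf g h x
        rw [show a + f h x + c' + f g (h * x) + c = a + (f h x + f g (h * x)) + c + c' by abel, this]
        abel
      one_mem' := ⟨-f 1 1, fun x a ↦ by simp [hf1 x]⟩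
      inv_mem' := by
        rintro ⟨g, σ⟩ ⟨c, hc⟩
        refine ⟨-c - f 1 1 - f g g⁻¹, fun x a ↦ ?_⟩
        simp only at hc
        simp only [Prod.inv_mk]
        rw [Equiv.Perm.inv_eq_iff_eq, hc, mul_inv_cancel_left, Prod.mk.injEq]
        refine ⟨rfl, ?_⟩
        have := hf g g⁻¹ x
        rw [mul_inv_cancel, hf1] at this
        rw [show a + f g⁻¹ x + (-c - f 1 1 - f g g⁻¹) + f g (g⁻¹ * x) + c =
          a + (f g⁻¹ x + f g (g⁻¹ * x)) - f 1 1 - f g g⁻¹ by abel, this]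
        abel }
  have hE : Function.Surjective ((MonoidHom.fst X (Equiv.Perm (X × k))).comp E.subtype) := by
    intro g
    let T : Equiv.Perm (X × k) :=
      { toFun := fun p ↦ (g * p.1, p.2 + f g p.1)
        invFun := fun p ↦ (g⁻¹ * p.1, p.2 - f g (g⁻¹ * p.1))
        left_inv := fun p ↦ by simp
        right_inv := fun p ↦ by simp }
    exact ⟨⟨(g, T), 0, fun x a ↦ by simp [T]⟩, rfl⟩
  obtain ⟨s, hs⟩ := IsFreeGroup.exists_lift _ hE (MonoidHom.id X)
  choose c hc using fun x ↦ (s x).2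
  have hs' (x : X) : (s x).1.1 = x := hs x
  simp only [hs'] at hc
  refine ⟨fun x ↦ -c x, fun x y ↦ ?_⟩
  have h1 := hc (x * y) 1 0
  rw [map_mul, Subgroup.coe_mul, Prod.snd_mul, Equiv.Perm.mul_apply, hc, hc, Prod.mk.injEq] at h1
  have h2 := h1.2
  have h3 := add_right_cancel ((congrArg (f y 1 + f x ·) (mul_one y)).symm.trans (hf x y 1))
  simp only [zero_add, mul_one, h3] at h2
  rw [add_assoc, add_assoc, add_right_inj] at h2
  beta_reduce
  rw [← h2]
  abel

/-- Over a group presented by one relator, all but one linear condition's worth of the invariant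
homomorphisms on the relation subgroup extend to the whole free group. -/
lemma exists_extension_obstruction {S H ι : Type*} [Group S] [IsFreeGroup S] [Group H] (q : S →* H)
    (hq : Function.Surjective q) {r : FreeGroup ι} (e : H ≃* PresentedGroup {r}) (A : Type*)
    [CommGroup A] : ∃ r₀ : q.ker, ∀ Θ : q.ker →* A,
      (∀ (s : S) (x y : q.ker), (y : S) = s * x * s⁻¹ → Θ y = Θ x) → Θ r₀ = 1 →
        ∃ Ψ : S →* A, ∀ x : q.ker, Ψ x = Θ x := by
  let q' : FreeGroup ι →* H := e.symm.toMonoidHom.comp (PresentedGroup.mk {r})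
  have hq' : Function.Surjective q' := e.symm.surjective.comp (PresentedGroup.mk_surjective _)
  have hker' (x : FreeGroup ι) : q' x = 1 ↔ x ∈ Subgroup.normalClosure {r} := by
    rw [← PresentedGroup.mk_eq_one_iff]
    exact e.symm.map_eq_one_iff
  obtain ⟨β, hβ⟩ := IsFreeGroup.exists_lift q hq q'
  obtain ⟨α, hα⟩ := IsFreeGroup.exists_lift q' hq' q
  have hβker {x : FreeGroup ι} (hx : x ∈ Subgroup.normalClosure {r}) : β x ∈ q.ker := by
    rw [MonoidHom.mem_ker, hβ, hker']
    exact hx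
  have hr : r ∈ Subgroup.normalClosure {r} := Subgroup.subset_normalClosure (Set.mem_singleton r)
  refine ⟨⟨β r, hβker hr⟩, fun Θ hΘ h0 ↦ ?_⟩
  have hΘβ (x : FreeGroup ι) (hx : x ∈ Subgroup.normalClosure {r}) : Θ ⟨β x, hβker hx⟩ = 1 := by
    refine Subgroup.closure_induction (p := fun x hx ↦ Θ ⟨β x, hβker hx⟩ = 1) ?_ ?_ ?_ ?_ hx
    · intro x hx
      obtain ⟨r', hr', hconj⟩ := Group.mem_conjugatesOfSet_iff.1 hx
      obtain rfl := Set.mem_singleton_iff.1 hr'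
      obtain ⟨u, rfl⟩ := isConj_iff.1 hconj
      rw [← h0]
      exact hΘ (β u) _ _ (by simp)
    · simp only [map_one]
      exact map_one Θ
    · intro x y hx hy h1 h2
      have h3 : (⟨β (x * y), hβker (mul_mem hx hy)⟩ : q.ker) =
        ⟨β x, hβker hx⟩ * ⟨β y, hβker hy⟩ := Subtype.ext (map_mul β x y)
      rw [h3, map_mul, h1, h2, mul_one]
    · intro x hx h1
      have h3 : (⟨β x⁻¹, hβker (inv_mem hx)⟩ : q.ker) = (⟨β x, hβker hx⟩)⁻¹ :=
        Subtype.ext (map_inv β x)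
      rw [h3, map_inv, h1, inv_one]
  have hρ (s : S) : (β (α s))⁻¹ * s ∈ q.ker := by
    simp [MonoidHom.mem_ker, hβ, hα]
  let Ψ : S →* A := MonoidHom.mk' (fun s ↦ Θ ⟨_, hρ s⟩) fun s t ↦ by
    have h1 : (β (α t))⁻¹ * ((β (α s))⁻¹ * s) * β (α t) ∈ q.ker := by
      simpa using (MonoidHom.normal_ker q).conj_mem _ (hρ s) (β (α t))⁻¹
    have h2 : (⟨_, hρ (s * t)⟩ : q.ker) = ⟨_, h1⟩ * ⟨_, hρ t⟩ := by
      ext1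
      simp [mul_assoc]
    rw [h2, map_mul, hΘ (β (α t))⁻¹ ⟨_, hρ s⟩ ⟨_, h1⟩ (by simp)]
  refine ⟨Ψ, fun x ↦ ?_⟩
  have hx : α x ∈ Subgroup.normalClosure {r} := by
    rw [← hker', hα]
    exact x.2
  have h1 : (⟨_, hρ x⟩ : q.ker) = ⟨β (α x), hβker hx⟩⁻¹ * x := rfl
  change Θ ⟨_, hρ x⟩ = _
  rw [h1, map_mul, map_inv, hΘβ _ hx, inv_one, one_mul]

/-- A cocycle descends to a coboundary once its cobounding function upstairs agrees with a
homomorphism on the kernel. -/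
lemma exists_cobounding_of_hom {X B k : Type*} [Group X] [Group B] [AddCommGroup k] (q : X →* B)
    (hq : Function.Surjective q) (f : B → B → k) (γ : X → k)
    (hγ : ∀ x y, f (q x) (q y) - f 1 1 = γ x + γ y - γ (x * y)) (Ψ : X →* Multiplicative k)
    (hΨ : ∀ x ∈ q.ker, (Ψ x).toAdd = γ x)
    (hmul : ∀ x ∈ q.ker, ∀ y, γ (x * y) = γ x + γ y) :
    ∃ η : B → k, ∀ b b', f b b' = η b + η b' - η (b * b') := by
  choose s hs using hq
  let δ (x : X) : k := γ x - (Ψ x).toAdd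
  have hδ {x y : X} (h : q x = q y) : δ x = δ y := by
    have hker : x * y⁻¹ ∈ q.ker := by simp [MonoidHom.mem_ker, h]
    have h1 := hmul _ hker y
    have h2 : Ψ (x * y⁻¹ * y) = Ψ (x * y⁻¹) * Ψ y := map_mul _ _ _
    rw [inv_mul_cancel_right] at h1 h2
    simp only [δ, h1, h2, toAdd_mul, hΨ _ hker]
    abel
  refine ⟨fun b ↦ δ (s b) + f 1 1, fun b b' ↦ ?_⟩
  have h1 : δ (s (b * b')) = δ (s b * s b') := hδ (by simp [hs])
  have h2 := hγ (s b) (s b')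
  rw [hs, hs, sub_eq_iff_eq_add] at h2
  beta_reduce
  rw [h1, h2]
  simp only [δ, map_mul, toAdd_mul]
  abel

namespace FreeGroup

/-- A function on a subgroup `K` additive on relations extends, on relations, to a homomorphism on
the relation subgroup invariant under the preimage of `H`. -/
lemma exists_hom_extending {α G k : Type*} [Fintype α] [Group G] [Field k] (π : FreeGroup α →* G)
    (hsurj : Function.Surjective π) {w : FreeGroup α} (hw : w ≠ 1)
    (hw' : ¬∃ (v : FreeGroup α) (r : ℕ), 2 ≤ r ∧ w = v ^ r)
    (hπ : π.ker = Subgroup.normalClosure {w}) (H : Subgroup G) (K : Subgroup (FreeGroup α))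
    (hwK : w ∈ K)
    (hK : ∀ x (hx : x ∈ K), x ∈ π.ker → ⟨x, hx⟩ ∈ Subgroup.normalClosure {(⟨w, hwK⟩ : K)})
    (γ : FreeGroup α → k)
    (hγ : ∀ x ∈ K, x ∈ π.ker → ∀ y ∈ K, π y ∈ H → γ (x * y) = γ x + γ y ∧ γ (y * x) = γ y + γ x) :
    ∃ Θ : π.ker →* Multiplicative k,
      (∀ s, π s ∈ H → ∀ x y : π.ker, (y : FreeGroup α) = s * x * s⁻¹ → Θ y = Θ x) ∧
        ∀ x : π.ker, (x : FreeGroup α) ∈ K → (Θ x).toAdd = γ x := by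
  classical
  have hwker : w ∈ π.ker := hπ ▸ Subgroup.subset_normalClosure (Set.mem_singleton w)
  have hconjK {t : FreeGroup α} (ht : t ∈ K) : t * w * t⁻¹ ∈ K :=
    mul_mem (mul_mem ht hwK) (inv_mem ht)
  have hconjR (t : FreeGroup α) : t * w * t⁻¹ ∈ π.ker :=
    (MonoidHom.normal_ker π).conj_mem _ hwker _
  have hinv {y : FreeGroup α} (hy : y ∈ K) (hyH : π y ∈ H) {x : FreeGroup α} (hx : x ∈ K)
      (hxR : x ∈ π.ker) : γ (y * x * y⁻¹) = γ x := by
    have h1 := (hγ x hx hxR y hy hyH).2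
    have h2 := (hγ (y * x * y⁻¹) (mul_mem (mul_mem hy hx) (inv_mem hy))
      ((MonoidHom.normal_ker π).conj_mem _ hxR _) y hy hyH).1
    rw [inv_mul_cancel_right, h1, add_comm] at h2
    exact (add_right_cancel h2).symm
  let u (g : G) : k := if h : ∃ t ∈ K, g * (π t)⁻¹ ∈ H then γ (h.choose * w * h.choose⁻¹) else 0
  have hu {t : FreeGroup α} (ht : t ∈ K) {g : G} (hg : g * (π t)⁻¹ ∈ H) :
      u g = γ (t * w * t⁻¹) := by
    have h : ∃ t ∈ K, g * (π t)⁻¹ ∈ H := ⟨t, ht, hg⟩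
    obtain ⟨h1, h2⟩ := h.choose_spec
    simp only [u, dif_pos h]
    set t' := h.choose
    have h3 : π (t' * t⁻¹) ∈ H := by
      have := mul_mem (inv_mem h2) hg
      simpa [mul_assoc] using this
    have h4 := hinv (mul_mem h1 (inv_mem ht)) h3 (hconjK ht) (hconjR t)
    rw [← h4]
    congr 1
    group
  have hu0 {g : G} (hg : ¬∃ t ∈ K, g * (π t)⁻¹ ∈ H) : u g = 0 := dif_neg hg
  have huH {s : G} (hs : s ∈ H) (g : G) : u (s * g) = u g := by
    by_cases h : ∃ t ∈ K, g * (π t)⁻¹ ∈ H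
    · obtain ⟨t, ht, hg⟩ := h
      rw [hu ht hg, hu ht]
      rw [mul_assoc]
      exact mul_mem hs hg
    · rw [hu0 h, hu0]
      rintro ⟨t, ht, hg⟩
      refine h ⟨t, ht, ?_⟩
      rw [mul_assoc] at hg
      exact (Subgroup.mul_mem_cancel_left _ hs).1 hg
  obtain ⟨Θ, hΘ⟩ := exists_hom_conj_eq π hsurj hw hw' hπ u
  refine ⟨Θ, fun s hs ↦ ?_, ?_⟩
  · have key : ∀ x ∈ Subgroup.normalClosure {w}, ∀ y z : π.ker, (y : FreeGroup α) = x →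
        (z : FreeGroup α) = s * x * s⁻¹ → Θ z = Θ y := by
      intro x hx
      refine Subgroup.closure_induction (p := fun x _ ↦ ∀ y z : π.ker, (y : FreeGroup α) = x →
        (z : FreeGroup α) = s * x * s⁻¹ → Θ z = Θ y) ?_ ?_ ?_ ?_ hx
      · intro x hx y z hy hz
        obtain ⟨w', hw', hconj⟩ := Group.mem_conjugatesOfSet_iff.1 hx
        obtain rfl := Set.mem_singleton_iff.1 hw'
        obtain ⟨g, rfl⟩ := isConj_iff.1 hconj
        rw [hΘ g y hy, hΘ (s * g) z (by rw [hz]; group), _root_.map_mul, huH hs]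
      · intro y z hy hz
        have h1 : y = 1 := Subtype.ext hy
        have h2 : z = 1 := Subtype.ext (by rw [hz]; simp)
        rw [h1, h2]
      · intro a b ha hb iha ihb y z hy hz
        rw [← Subgroup.normalClosure, ← hπ] at ha hb
        have ha' := (MonoidHom.normal_ker π).conj_mem _ ha s
        have hb' := (MonoidHom.normal_ker π).conj_mem _ hb s
        have h1 : y = ⟨a, ha⟩ * ⟨b, hb⟩ := Subtype.ext hy
        have h2 : z = ⟨_, ha'⟩ * ⟨_, hb'⟩ := Subtype.ext (by rw [hz]; simp)
        rw [h1, h2, _root_.map_mul, _root_.map_mul, iha ⟨a, ha⟩ ⟨_, ha'⟩ rfl rfl,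
          ihb ⟨b, hb⟩ ⟨_, hb'⟩ rfl rfl]
      · intro a ha iha y z hy hz
        have h1 := iha y⁻¹ z⁻¹ (by simp [hy]) (by simp [hz, mul_assoc])
        rwa [_root_.map_inv, _root_.map_inv, inv_inj] at h1
    intro x y hxy
    exact key x (hπ ▸ x.2) x y rfl hxy
  · intro x hxK
    have key : ∀ a ∈ Subgroup.normalClosure {(⟨w, hwK⟩ : K)}, ∀ y : π.ker, (y : FreeGroup α) = a →
        (Θ y).toAdd = γ y := by
      have hker : ∀ a ∈ Subgroup.normalClosure {(⟨w, hwK⟩ : K)}, (a : FreeGroup α) ∈ π.ker := by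
        intro a ha
        have : Subgroup.normalClosure {(⟨w, hwK⟩ : K)} ≤ π.ker.comap K.subtype :=
          Subgroup.normalClosure_le_normal (by simpa [Subgroup.mem_subgroupOf] using hwker)
        exact this ha
      have hadd {a b : FreeGroup α} (ha : a ∈ K) (ha' : a ∈ π.ker) (hb : b ∈ K)
          (hb' : b ∈ π.ker) : γ (a * b) = γ a + γ b :=
        (hγ a ha ha' b hb (by rw [MonoidHom.mem_ker.1 hb']; exact one_mem H)).1
      have hone : γ 1 = 0 := by
        simpa using hadd (one_mem K) (one_mem π.ker) (one_mem K) (one_mem π.ker)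
      intro a ha
      refine Subgroup.closure_induction (p := fun (a : K) _ ↦ ∀ y : π.ker, (y : FreeGroup α) = a →
        (Θ y).toAdd = γ y) ?_ ?_ ?_ ?_ ha
      · intro a ha y hy
        obtain ⟨w', hw', hconj⟩ := Group.mem_conjugatesOfSet_iff.1 ha
        obtain rfl := Set.mem_singleton_iff.1 hw'
        obtain ⟨t, rfl⟩ := isConj_iff.1 hconj
        have h1 : (y : FreeGroup α) = t * w * (t : FreeGroup α)⁻¹ := hy
        rw [hΘ t y h1, toAdd_ofAdd, hu t.2 (by simp), h1]
      · intro y hy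
        have h1 : y = 1 := Subtype.ext hy
        simp [h1, hone]
      · intro a b ha hb iha ihb y hy
        have h1 : y = ⟨a, hker a ha⟩ * ⟨b, hker b hb⟩ := Subtype.ext hy
        rw [h1, _root_.map_mul, toAdd_mul, iha ⟨a, _⟩ rfl, ihb ⟨b, _⟩ rfl]
        exact (hadd a.2 (hker a ha) b.2 (hker b hb)).symm
      · intro a ha iha y hy
        have h1 := iha y⁻¹ (by simp [hy])
        have hyK : (y : FreeGroup α) ∈ K := hy ▸ (a⁻¹).2
        have h2 := hadd hyK y.2 (inv_mem hyK) (inv_mem y.2)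
        rw [mul_inv_cancel, hone] at h2
        rw [_root_.map_inv, toAdd_inv, Subgroup.coe_inv] at h1
        rw [← neg_eq_iff_add_eq_zero.2 h2.symm] at h1
        exact neg_injective (by simpa using h1)
    exact key _ (hK x hxK x.2) x rfl

end FreeGroup

/-- If any two 2-cocycles have a nontrivial linear combination which is a coboundary, then the
second cohomology is at most one-dimensional. -/
lemma groupCohomology.rank_H2_trivial_le_one {B k : Type} [Group B] [Field k]
    (h : ∀ f₁ f₂ : B → B → k, (∀ x y z, f₁ y z + f₁ x (y * z) = f₁ (x * y) z + f₁ x y) →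
      (∀ x y z, f₂ y z + f₂ x (y * z) = f₂ (x * y) z + f₂ x y) →
      ∃ a b : k, (a ≠ 0 ∨ b ≠ 0) ∧ ∃ η : B → k, ∀ x y,
        a * f₁ x y + b * f₂ x y = η x + η y - η (x * y)) :
    Module.rank k (groupCohomology (Rep.trivial k B k) 2) ≤ 1 := by
  let A := Rep.trivial k B k
  have key (u v : groupCohomology A 2) : ∃ a b : k, (a ≠ 0 ∨ b ≠ 0) ∧ a • u + b • v = 0 := by
    induction u using groupCohomology.H2_induction_on with | _ f₁
    induction v using groupCohomology.H2_induction_on with | _ f₂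
    have hf (f : groupCohomology.cocycles₂ A) (x y z : B) :
        f (y, z) + f (x, y * z) = f (x * y, z) + f (x, y) :=
      ((groupCohomology.mem_cocycles₂_iff (A := A) f).1 f.2 x y z).symm
    obtain ⟨a, b, hab, η, hη⟩ := h (fun x y ↦ f₁ (x, y)) (fun x y ↦ f₂ (x, y)) (hf f₁) (hf f₂)
    refine ⟨a, b, hab, ?_⟩
    rw [← map_smul, ← map_smul, ← map_add, groupCohomology.H2π_eq_zero_iff]
    refine ⟨η, ?_⟩
    ext ⟨x, y⟩
    refine Eq.trans ?_ (hη x y).symm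
    change η y - η (x * y) + η x = _
    ring
  rw [rank_le_one_iff]
  by_cases h0 : ∀ v : groupCohomology A 2, v = 0
  · exact ⟨0, fun v ↦ ⟨0, by rw [smul_zero, h0 v]⟩⟩
  · push Not at h0
    obtain ⟨v₀, hv₀⟩ := h0
    refine ⟨v₀, fun v ↦ ?_⟩
    obtain ⟨a, b, hab, hsum⟩ := key v₀ v
    have hb : b ≠ 0 := by
      rintro rfl
      rw [zero_smul, add_zero] at hsum
      exact (smul_ne_zero (hab.resolve_right (by simp)) hv₀) hsum
    refine ⟨-(b⁻¹ * a), ?_⟩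
    rw [neg_smul, mul_smul, eq_neg_of_add_eq_zero_left hsum, smul_neg, inv_smul_smul₀ hb, neg_neg]

namespace FreeGroup

variable {α G k : Type*} [Fintype α] [Group G] [Field k] (π : FreeGroup α →* G)
  {w : FreeGroup α} {H : Subgroup G} {K : Subgroup (FreeGroup α)} {B : Type*} [Group B]

/-- A cocycle inflated to a free group is cobounded by a function which extends, on relations, to a
homomorphism on the whole relation subgroup. -/
lemma exists_cobounding_extending (hsurj : Function.Surjective π) (hw : w ≠ 1)
    (hw' : ¬∃ (v : FreeGroup α) (r : ℕ), 2 ≤ r ∧ w = v ^ r)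
    (hπ : π.ker = Subgroup.normalClosure {w}) (hwK : w ∈ K)
    (hK : ∀ x (hx : x ∈ K), x ∈ π.ker → ⟨x, hx⟩ ∈ Subgroup.normalClosure {(⟨w, hwK⟩ : K)})
    (q : ↥(K ⊓ H.comap π) →* B) (hq : ∀ x, q x = 1 ↔ (x : FreeGroup α) ∈ π.ker) (f : B → B → k)
    (hf : ∀ x y z, f y z + f x (y * z) = f (x * y) z + f x y) :
    ∃ γ : ↥(K ⊓ H.comap π) → k, (∀ x y, f (q x) (q y) - f 1 1 = γ x + γ y - γ (x * y)) ∧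
      ∃ Θ : π.ker →* Multiplicative k,
        (∀ s, π s ∈ H → ∀ x y : π.ker, (y : FreeGroup α) = s * x * s⁻¹ → Θ y = Θ x) ∧
          ∀ (x : ↥(K ⊓ H.comap π)) (hx : (x : FreeGroup α) ∈ π.ker), (Θ ⟨x, hx⟩).toAdd = γ x := by
  classical
  obtain ⟨γ', hγ'⟩ := IsFreeGroup.exists_cobounding (fun x y ↦ f (q x) (q y)) fun x y z ↦ by
    simpa using hf (q x) (q y) (q z)
  let γ (x : ↥(K ⊓ H.comap π)) : k := γ' x - f 1 1
  have hγ (x y) : f (q x) (q y) - f 1 1 = γ x + γ y - γ (x * y) := by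
    rw [hγ']
    simp only [γ]
    abel
  have hf1 (x : B) : f 1 x = f 1 1 := by simpa using hf 1 1 x
  have hf2 (x : B) : f x 1 = f 1 1 := by simpa using (hf x 1 1).symm
  let γ₀ (x : FreeGroup α) : k := if hx : x ∈ K ⊓ H.comap π then γ ⟨x, hx⟩ else 0
  have hγ₀ (x : ↥(K ⊓ H.comap π)) : γ₀ x = γ x := dif_pos x.2
  obtain ⟨Θ, hΘ, hΘγ⟩ := exists_hom_extending π hsurj hw hw' hπ H K hwK hK γ₀
    fun x hx hxR y hy hyH ↦ by
      have hxH : x ∈ K ⊓ H.comap π :=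
        ⟨hx, by change π x ∈ H; rw [MonoidHom.mem_ker.1 hxR]; exact one_mem H⟩
      have hqx := (hq ⟨x, hxH⟩).2 hxR
      have h1 := hγ ⟨x, hxH⟩ ⟨y, hy, hyH⟩
      have h2 := hγ ⟨y, hy, hyH⟩ ⟨x, hxH⟩
      rw [hqx, hf1, sub_self, eq_comm, sub_eq_zero, ← hγ₀, ← hγ₀, ← hγ₀] at h1
      rw [hqx, hf2, sub_self, eq_comm, sub_eq_zero, ← hγ₀, ← hγ₀, ← hγ₀] at h2
      exact ⟨h1.symm, h2.symm⟩
  exact ⟨γ, hγ, Θ, hΘ, fun x hx ↦ by rw [hΘγ _ x.2.1, hγ₀]⟩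

/-- If a subgroup `H` of a torsion-free one-relator group is a one-relator group then any two
two-cocycles on `H ∩ P` become proportional in cohomology, where `P` is presented by the same
relator. -/
theorem exists_combination_cobounding (hsurj : Function.Surjective π) (hw : w ≠ 1)
    (hw' : ¬∃ (v : FreeGroup α) (r : ℕ), 2 ≤ r ∧ w = v ^ r)
    (hπ : π.ker = Subgroup.normalClosure {w}) (hwK : w ∈ K)
    (hK : ∀ x (hx : x ∈ K), x ∈ π.ker → ⟨x, hx⟩ ∈ Subgroup.normalClosure {(⟨w, hwK⟩ : K)})
    {ι : Type*} {r : FreeGroup ι} (e : H ≃* PresentedGroup {r})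
    (q : ↥(K ⊓ H.comap π) →* B) (hq : ∀ x, q x = 1 ↔ (x : FreeGroup α) ∈ π.ker)
    (hqsurj : Function.Surjective q) (f₁ f₂ : B → B → k)
    (hf₁ : ∀ x y z, f₁ y z + f₁ x (y * z) = f₁ (x * y) z + f₁ x y)
    (hf₂ : ∀ x y z, f₂ y z + f₂ x (y * z) = f₂ (x * y) z + f₂ x y) :
    ∃ a b : k, (a ≠ 0 ∨ b ≠ 0) ∧ ∃ η : B → k, ∀ x y,
      a * f₁ x y + b * f₂ x y = η x + η y - η (x * y) := by
  obtain ⟨γ₁, hγ₁, Θ₁, hΘ₁, hΘγ₁⟩ :=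
    exists_cobounding_extending π hsurj hw hw' hπ hwK hK q hq f₁ hf₁
  obtain ⟨γ₂, hγ₂, Θ₂, hΘ₂, hΘγ₂⟩ :=
    exists_cobounding_extending π hsurj hw hw' hπ hwK hK q hq f₂ hf₂
  let p : ↥(H.comap π) →* H := π.subgroupComap H
  have hp : Function.Surjective p := π.subgroupComap_surjective_of_surjective H hsurj
  obtain ⟨r₀, hr₀⟩ := exists_extension_obstruction p hp e (Multiplicative k)
  have hpker (x : p.ker) : ((x : ↥(H.comap π)) : FreeGroup α) ∈ π.ker :=
    congrArg Subtype.val (MonoidHom.mem_ker.1 x.2)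
  let j : p.ker →* π.ker := ((H.comap π).subtype.comp p.ker.subtype).codRestrict π.ker hpker
  obtain ⟨a, b, hab, hzero⟩ : ∃ a b : k, (a ≠ 0 ∨ b ≠ 0) ∧
      a * (Θ₁ (j r₀)).toAdd + b * (Θ₂ (j r₀)).toAdd = 0 := by
    by_cases h : (Θ₁ (j r₀)).toAdd = 0
    · exact ⟨1, 0, by simp, by simp [h]⟩
    · exact ⟨(Θ₂ (j r₀)).toAdd, -(Θ₁ (j r₀)).toAdd, by simp [h], by ring⟩
  let Θ : π.ker →* Multiplicative k :=
    (AddMonoidHom.toMultiplicative (AddMonoidHom.mulLeft a)).comp Θ₁ *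
      (AddMonoidHom.toMultiplicative (AddMonoidHom.mulLeft b)).comp Θ₂
  have hΘ (x : π.ker) : (Θ x).toAdd = a * (Θ₁ x).toAdd + b * (Θ₂ x).toAdd := rfl
  obtain ⟨Ψ, hΨ⟩ := hr₀ (Θ.comp j) (fun s x y hxy ↦ by
    have h1 : ((j y : π.ker) : FreeGroup α) = s * j x * (s : FreeGroup α)⁻¹ :=
      congrArg Subtype.val hxy
    refine Multiplicative.toAdd.injective ?_
    simp only [MonoidHom.comp_apply, hΘ]
    rw [hΘ₁ s s.2 _ _ h1, hΘ₂ s s.2 _ _ h1]) hzero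
  have hf1 {f : B → B → k} (hf : ∀ x y z, f y z + f x (y * z) = f (x * y) z + f x y) (x : B) :
      f 1 x = f 1 1 := by simpa using hf 1 1 x
  refine ⟨a, b, hab, exists_cobounding_of_hom q hqsurj _ (fun x ↦ a * γ₁ x + b * γ₂ x)
    (fun x y ↦ ?_) (Ψ.comp (Subgroup.inclusion inf_le_right)) (fun x hx ↦ ?_) fun x hx y ↦ ?_⟩
  · linear_combination a * hγ₁ x y + b * hγ₂ x y
  · have hxR := (hq x).1 hx
    have h1 : Subgroup.inclusion inf_le_right x ∈ p.ker := Subtype.ext hxR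
    have h2 := hΨ ⟨_, h1⟩
    rw [MonoidHom.comp_apply, h2, MonoidHom.comp_apply, hΘ]
    rw [← hΘγ₁ x hxR, ← hΘγ₂ x hxR]
    rfl
  · have h1 := hγ₁ x y
    have h2 := hγ₂ x y
    rw [MonoidHom.mem_ker.1 hx, hf1 hf₁, sub_self] at h1
    rw [MonoidHom.mem_ker.1 hx, hf1 hf₂, sub_self] at h2
    linear_combination a * h1 + b * h2

end FreeGroup

/-- In the Mel'nikov setting, if `P = K/⟨⟨w⟩⟩_K` embeds in `G = F/⟨⟨w⟩⟩` as a non-free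
subgroup, where `K ≤ F` has rank two and contains `w`, then for every finite-index normal
subgroup `H ⊴ G` and every prime `p`, `dim_{𝔽_p} H²(H ∩ P; 𝔽_p) ≤ 1`. -/
theorem stmt15 (n : ℕ) (hn : 3 ≤ n) (w : FreeGroup (Fin n)) (hw1 : w ≠ 1)
    (hwnotprim : ¬ ∃ (ι : Type) (b : FreeGroupBasis ι (FreeGroup (Fin n))) (i : ι), b i = w)
    (hwnotpow : ¬ ∃ (v : FreeGroup (Fin n)) (r : ℕ), 2 ≤ r ∧ w = v ^ r)
    (hres : ResiduallyFinite (FreeGroup (Fin n) ⧸ Subgroup.normalClosure {w}))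
    (hmel : ∀ H : Subgroup (FreeGroup (Fin n) ⧸ Subgroup.normalClosure {w}),
      H.FiniteIndex → IsOneRelatorGroup H)
    (K : Subgroup (FreeGroup (Fin n))) (hK2 : Nonempty (FreeGroupBasis (Fin 2) K))
    (hwK : w ∈ K)
    (hinj : Function.Injective (canonicalMap n w K hwK))
    (hPnotfree : ¬ IsFreeGroup (↥K ⧸ Subgroup.normalClosure {(⟨w, hwK⟩ : K)})) :
    ∀ H : Subgroup (FreeGroup (Fin n) ⧸ Subgroup.normalClosure {w}),
      H.Normal → H.FiniteIndex → ∀ p : ℕ, p.Prime →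
        Module.rank (ZMod p)
          (groupCohomology
            (Rep.trivial (ZMod p) ↥(H ⊓ (canonicalMap n w K hwK).range) (ZMod p)) 2) ≤ 1 := by
  intro H _ hH p hp
  have := Fact.mk hp
  let π := QuotientGroup.mk' (Subgroup.normalClosure {w})
  have hsurj : Function.Surjective π := QuotientGroup.mk'_surjective _
  have hker : π.ker = Subgroup.normalClosure {w} := QuotientGroup.ker_mk' _
  obtain ⟨m, r, ⟨e⟩⟩ := hmel H hH
  have hmap (x : K) : canonicalMap n w K hwK (QuotientGroup.mk x) = π x := rfl
  let q : ↥(K ⊓ H.comap π) →* ↥(H ⊓ (canonicalMap n w K hwK).range) :=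
    (π.comp (K ⊓ H.comap π).subtype).codRestrict _
      fun x ↦ ⟨x.2.2, QuotientGroup.mk ⟨x, x.2.1⟩, rfl⟩
  have hq (x) : q x = 1 ↔ (x : FreeGroup (Fin n)) ∈ π.ker := Subtype.ext_iff
  have hqsurj : Function.Surjective q := by
    rintro ⟨b, hbH, t, rfl⟩
    obtain ⟨x, rfl⟩ := QuotientGroup.mk_surjective t
    exact ⟨⟨x, x.2, hbH⟩, rfl⟩
  refine groupCohomology.rank_H2_trivial_le_one fun f₁ f₂ hf₁ hf₂ ↦
    FreeGroup.exists_combination_cobounding π hsurj hw1 hwnotpow hker hwK (fun x hx hxR ↦ ?_)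
      e q hq hqsurj f₁ f₂ hf₁ hf₂
  refine (QuotientGroup.eq_one_iff _).1 (hinj ?_)
  rw [hmap, map_one]
  exact hxR
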